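/- arXiv:1209.2570 — 2 statements merged into one kernel-verified Lean document; each statement's English description precedes it below -/
import Mathlib

section
/- There exist λ > 1, K > 0 and δ > 0 such that, whenever α > 0 is sufficiently small, the following holds. Let (θ,x) ∈ (ℝ/ℤ)×B and write (θ_j,x_j) = F^j(θ,x). If |x_0|, |x_1|, …, |x_{n−1}| ≥ α^{0.6}, then |∂f_n(θ,x)/∂x| ≥ K·α^{0.6}·λ^n. If in addition |x_n| < δ, then |∂f_n(θ,x)/∂x| ≥ K·λ^n. -/
open Set MeasureTheory Filter
open scoped ENNReal

noncomputable section

/-- The quadratic map `f(x) = a - x²`. -/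
def qm (a : ℝ) : ℝ → ℝ := fun x => a - x ^ 2

/-- The critical point `0` of `qm a` is strictly pre-periodic: its forward orbit never
returns to `0` and is eventually periodic. -/
def StrictlyPreperiodic (a : ℝ) : Prop :=
  (∀ i : ℕ, 1 ≤ i → (qm a)^[i] 0 ≠ 0) ∧
    ∃ m p : ℕ, 1 ≤ m ∧ 1 ≤ p ∧ (qm a)^[m + p] 0 = (qm a)^[m] 0

/-- A lift of the Viana skew product `F(θ, x) = (dθ, f(x) + αφ(θ))` to `ℝ × ℝ`;
for `φ` of period `1` this is a lift of the corresponding map of `(ℝ/ℤ) × ℝ`. -/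
def Viana (a : ℝ) (d : ℕ) (φ : ℝ → ℝ) (α : ℝ) : ℝ × ℝ → ℝ × ℝ :=
  fun p => ((d : ℝ) * p.1, qm a p.2 + α * φ p.1)

/-- The fibre maps `f_n`, defined by `F^n(θ, x) = (d^n θ, f_n(θ, x))`. -/
def fn (a : ℝ) (d : ℕ) (φ : ℝ → ℝ) (α : ℝ) (n : ℕ) (θ x : ℝ) : ℝ :=
  ((Viana a d φ α)^[n] (θ, x)).2

/-- The post-critical data of `x ↦ a - x²`: a finite forward invariant set `P ⊆ (-2, 2)` which
contains the critical value `a` but not the critical point `0`. -/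
structure IsPostcritical (a : ℝ) (P : Finset ℝ) : Prop where
  pos : 0 < a
  lt_two : a < 2
  mem : a ∈ P
  map_mem : ∀ c ∈ P, a - c ^ 2 ∈ P
  ne_zero : ∀ c ∈ P, c ≠ 0
  abs_lt_two : ∀ c ∈ P, |c| < 2

/-- The density at `x` of the Hilbert metric of the component containing `x` of
`(-2, 2) \ (P \ {x})`. The convention `0⁻¹ = 0` discards the point `x` itself. -/
def hilb (P : Finset ℝ) (x : ℝ) : ℝ :=
  (insert (-2) (insert 2 P)).sup' (Finset.insert_nonempty _ _) (fun e => (x - e)⁻¹) +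
    (insert (-2) (insert 2 P)).sup' (Finset.insert_nonempty _ _) (fun e => (e - x)⁻¹)

theorem add_le_hilb {P : Finset ℝ} {x l r : ℝ} (hl : l ∈ insert (-2) (insert 2 P))
    (hr : r ∈ insert (-2) (insert 2 P)) : (x - l)⁻¹ + (r - x)⁻¹ ≤ hilb P x :=
  add_le_add (Finset.le_sup' (fun e => (x - e)⁻¹) hl) (Finset.le_sup' (fun e => (e - x)⁻¹) hr)

theorem hilb_le_add {P : Finset ℝ} {x A B : ℝ}
    (h : ∀ e ∈ insert (-2) (insert 2 P), (x - e)⁻¹ ≤ A ∧ (e - x)⁻¹ ≤ B) : hilb P x ≤ A + B :=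
  add_le_add (Finset.sup'_le _ _ fun e he => (h e he).1) (Finset.sup'_le _ _ fun e he => (h e he).2)

theorem one_le_hilb {P : Finset ℝ} {x : ℝ} (hx : |x| < 2) : 1 ≤ hilb P x := by
  obtain ⟨h1, h2⟩ := abs_lt.1 hx
  refine le_trans ?_ (add_le_hilb (P := P) (x := x) (l := -2) (r := 2) (by simp) (by simp))
  have h3 : 0 < x - -2 := by linarith
  have h4 : 0 < 2 - x := by linarith
  rw [inv_add_inv h3.ne' h4.ne', le_div_iff₀ (by positivity)]
  nlinarith [sq_nonneg x]

theorem inv_abs_sub_le_hilb {P : Finset ℝ} {x c : ℝ} (hx : |x| < 2) (hc : c ∈ P) :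
    |x - c|⁻¹ ≤ hilb P x := by
  obtain ⟨h1, h2⟩ := abs_lt.1 hx
  have h3 : 0 < (x - -2)⁻¹ := inv_pos.2 (by linarith)
  have h4 : 0 < (2 - x)⁻¹ := inv_pos.2 (by linarith)
  rcases le_total c x with h | h
  · rw [abs_of_nonneg (by linarith)]
    have := add_le_hilb (P := P) (x := x) (l := c) (r := 2) (by simp [hc]) (by simp)
    linarith
  · rw [abs_of_nonpos (by linarith), neg_sub]
    have := add_le_hilb (P := P) (x := x) (l := -2) (r := c) (by simp) (by simp [hc])
    linarith

theorem hilb_le_two_div {P : Finset ℝ} {x r : ℝ} (hr : 0 < r) (hx : |x| + r ≤ 2)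
    (h : ∀ c ∈ P, r ≤ |x - c|) : hilb P x ≤ 2 / r := by
  have key : ∀ e ∈ insert (-2) (insert 2 P), r ≤ |x - e| := by
    intro e he
    simp only [Finset.mem_insert] at he
    rcases he with rfl | rfl | he
    · rw [le_abs]; left; linarith [neg_abs_le x]
    · rw [le_abs]; right; linarith [le_abs_self x]
    · exact h e he
  have : hilb P x ≤ r⁻¹ + r⁻¹ := by
    refine hilb_le_add fun e he => ⟨?_, ?_⟩
    · refine (le_abs_self _).trans ?_
      rw [abs_inv]
      exact inv_anti₀ hr (key e he)
    · refine (le_abs_self _).trans ?_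
      rw [abs_inv, abs_sub_comm]
      exact inv_anti₀ hr (key e he)
  calc hilb P x ≤ r⁻¹ + r⁻¹ := this
    _ = 2 / r := by ring

theorem continuousOn_hilb (P : Finset ℝ) :
    ContinuousOn (hilb P) {x | |x| < 2 ∧ ∀ c ∈ P, x ≠ c} := by
  have key : ∀ x ∈ {x : ℝ | |x| < 2 ∧ ∀ c ∈ P, x ≠ c},
      ∀ e ∈ insert (-2) (insert 2 P), x - e ≠ 0 := by
    rintro x ⟨hx, hP⟩ e he
    obtain ⟨h1, h2⟩ := abs_lt.1 hx
    simp only [Finset.mem_insert] at he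
    rcases he with rfl | rfl | he
    · exact (by linarith : 0 < x - -2).ne'
    · exact (by linarith : x - 2 < 0).ne
    · exact sub_ne_zero.2 (hP e he)
  refine ContinuousOn.add ?_ ?_
  · refine ContinuousOn.finset_sup'_apply _ fun e he => ?_
    exact ContinuousOn.inv₀ (by fun_prop) fun x hx => key x hx e he
  · refine ContinuousOn.finset_sup'_apply _ fun e he => ?_
    refine ContinuousOn.inv₀ (by fun_prop) fun x hx => ?_
    rw [← neg_sub]
    exact neg_ne_zero.2 (key x hx e he)

theorem inv_sub_le_of_abs_le_or {u v x e : ℝ} (hu : 0 ≤ u) (hux : u < x) (hxv : x < v)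
    (he : |e| ≤ u ∨ v ≤ |e| ∨ |e| = x) :
    (x - e)⁻¹ ≤ (x - u)⁻¹ ∧ (e - x)⁻¹ ≤ (v - x)⁻¹ := by
  have h1 : 0 < x - u := by linarith
  have h2 : 0 < v - x := by linarith
  have p1 := (inv_pos.2 h1).le
  have p2 := (inv_pos.2 h2).le
  have small : e ≤ u → (x - e)⁻¹ ≤ (x - u)⁻¹ ∧ (e - x)⁻¹ ≤ (v - x)⁻¹ := fun h =>
    ⟨inv_anti₀ h1 (by linarith), (inv_nonpos.2 (by linarith)).trans p2⟩
  rcases he with he | he | he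
  · exact small ((le_abs_self e).trans he)
  · rcases le_abs.1 he with h | h
    · exact ⟨(inv_nonpos.2 (by linarith)).trans p1, inv_anti₀ h2 (by linarith)⟩
    · exact small (by linarith)
  · rcases (abs_eq (by linarith)).1 he with h | h
    · subst h; simp [p1, p2]
    · exact small (by linarith)

/-- The quadratic map strictly expands the Hilbert metric. -/
theorem IsPostcritical.hilb_lt {a : ℝ} {P : Finset ℝ} (hP : IsPostcritical a P) {x : ℝ}
    (hx0 : x ≠ 0) (hy : |a - x ^ 2| < 2) :
    hilb P x < hilb P (a - x ^ 2) * |2 * x| := by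
  obtain ⟨hy1, hy2⟩ := abs_lt.1 hy
  set E : Finset ℝ := insert (-2) (insert 2 P) with hE
  have hX : 0 < |x| := abs_pos.2 hx0
  have hsq : |x| ^ 2 = x ^ 2 := sq_abs x
  obtain ⟨l, hl, hlmax⟩ := Finset.exists_max_image (E.filter (· < a - x ^ 2)) id
    ⟨-2, by simp [hE, hy1]⟩
  obtain ⟨r, hr, hrmin⟩ := Finset.exists_min_image (E.filter (a - x ^ 2 < ·)) id
    ⟨2, by simp only [hE, Finset.mem_filter, Finset.mem_insert]; exact ⟨by simp, hy2⟩⟩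
  simp only [Finset.mem_filter, id] at hl hr hlmax hrmin
  have hra : r ≤ a := hrmin a ⟨by simp [hE, hP.mem], by nlinarith⟩
  have hl2 : -2 ≤ l := hlmax (-2) ⟨by simp [hE], hy1⟩
  obtain ⟨u, hu0, hu⟩ : ∃ u, 0 ≤ u ∧ u ^ 2 = a - r :=
    ⟨√(a - r), Real.sqrt_nonneg _, Real.sq_sqrt (by linarith)⟩
  obtain ⟨v, hv0, hv⟩ : ∃ v, 0 ≤ v ∧ v ^ 2 = a - l :=
    ⟨√(a - l), Real.sqrt_nonneg _, Real.sq_sqrt (by linarith [hl.2, hr.2])⟩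
  have hux : u < |x| := lt_of_pow_lt_pow_left₀ 2 hX.le (by linarith [hr.2])
  have hxv : |x| < v := lt_of_pow_lt_pow_left₀ 2 hv0 (by linarith [hl.2])
  have hv2 : v ≤ 2 := by
    have := hP.lt_two
    nlinarith
  have tri : ∀ e ∈ E, |e| ≤ u ∨ v ≤ |e| ∨ |e| = |x| := by
    intro e he
    have two : |e| = 2 → v ≤ |e| := fun h => h ▸ hv2
    have he' := he
    simp only [hE, Finset.mem_insert] at he'
    rcases he' with rfl | rfl | he'
    · right; left; exact two (by norm_num)
    · right; left; exact two (by norm_num)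
    have hfe : a - e ^ 2 ∈ E := by simp [hE, hP.map_mem e he']
    rcases lt_trichotomy (a - e ^ 2) (a - x ^ 2) with h | h | h
    · have := hlmax _ ⟨hfe, h⟩
      right; left
      exact le_of_sq_le_sq (by rw [sq_abs]; linarith) (abs_nonneg e)
    · right; right
      exact (sq_eq_sq_iff_abs_eq_abs _ _).1 (by linarith)
    · have := hrmin _ ⟨hfe, h⟩
      left
      exact le_of_sq_le_sq (by rw [sq_abs]; linarith) hu0
  have upper : hilb P x ≤ (|x| - u)⁻¹ + (v - |x|)⁻¹ := by
    rcases abs_cases x with ⟨h, -⟩ | ⟨h, -⟩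
    · refine hilb_le_add fun e he => ?_
      have := inv_sub_le_of_abs_le_or hu0 hux hxv (tri e he)
      rwa [h] at this ⊢
    · rw [add_comm]
      refine hilb_le_add fun e he => ?_
      have := inv_sub_le_of_abs_le_or (e := -e) hu0 hux hxv (by rw [abs_neg]; exact tri e he)
      rw [h] at this ⊢
      rw [show x - e = -e - -x by ring, show e - x = -x - -e by ring]
      exact this.symm
  have lower := add_le_hilb (P := P) (x := a - x ^ 2) hl.1 hr.1
  have h2x : |2 * x| = 2 * |x| := by rw [abs_mul]; norm_num
  rw [h2x]
  refine upper.trans_lt (lt_of_lt_of_le ?_ (mul_le_mul_of_nonneg_right lower (by positivity)))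
  have e1 : a - x ^ 2 - l = (v - |x|) * (v + |x|) := by nlinarith
  have e2 : r - (a - x ^ 2) = (|x| - u) * (|x| + u) := by nlinarith
  rw [e1, e2]
  generalize |x| = X at *
  have h1 : 0 < X - u := by linarith
  have h2 : 0 < v - X := by linarith
  have h3 : 0 < X + u := by linarith
  have h4 : 0 < v + X := by linarith
  have h5 : (v + X)⁻¹ < (X + u)⁻¹ := inv_strictAnti₀ h3 (by linarith)
  have i1 : ((v - X) * (v + X))⁻¹ * (2 * X) = (v - X)⁻¹ - (v + X)⁻¹ := by
    field_simp; ring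
  have i2 : ((X - u) * (X + u))⁻¹ * (2 * X) = (X - u)⁻¹ + (X + u)⁻¹ := by
    field_simp; ring
  rw [add_mul, i1, i2]
  linarith

theorem Finset.exists_pos_forall_le {ι : Type*} (s : Finset ι) (g : ι → ℝ) (hg : ∀ i ∈ s, 0 < g i) :
    ∃ m > 0, ∀ i ∈ s, m ≤ g i := by
  rcases s.eq_empty_or_nonempty with rfl | hs
  · exact ⟨1, one_pos, by simp⟩
  · obtain ⟨i, hi, hmin⟩ := s.exists_min_image g hs
    exact ⟨g i, hg i hi, hmin⟩

/-- The density at `x` of the regularised singular metric around the post-critical point `c`. -/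
def nearDensity (P : Finset ℝ) (C α c x : ℝ) : ℝ :=
  hilb P c / (hilb P c * |x - c| + C * α) ^ (0.6 : ℝ)

theorem abs_sub_map_le {a x z c α : ℝ} (hz : |z - (a - x ^ 2)| ≤ α) :
    |z - (a - c ^ 2)| ≤ |x + c| * |x - c| + α := by
  calc |z - (a - c ^ 2)| = |(z - (a - x ^ 2)) + -((x + c) * (x - c))| := by ring_nf
    _ ≤ |z - (a - x ^ 2)| + |-((x + c) * (x - c))| := abs_add_le _ _
    _ ≤ _ := by rw [abs_neg, abs_mul]; linarith

theorem le_abs_sub_map {a x z c α : ℝ} (hz : |z - (a - x ^ 2)| ≤ α) :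
    |x + c| * |x - c| - α ≤ |z - (a - c ^ 2)| := by
  rw [← abs_mul, show (x + c) * (x - c) = (z - (a - x ^ 2)) - (z - (a - c ^ 2)) by ring]
  linarith [abs_sub (z - (a - x ^ 2)) (z - (a - c ^ 2))]

theorem abs_bounds_of_near {x c ε : ℝ} (h : |x - c| ≤ ε * |c|) :
    (1 - ε) * |c| ≤ |x| ∧ (2 - ε) * |c| ≤ |x + c| ∧ |x + c| ≤ (2 + ε) * |c| := by
  have h2c : |2 * c| = 2 * |c| := by rw [abs_mul]; norm_num
  have h1 : |c| ≤ |x| + |x - c| := by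
    calc |c| = |x - (x - c)| := by ring_nf
      _ ≤ _ := abs_sub _ _
  have h2 : |2 * c| ≤ |x + c| + |x - c| := by
    calc |2 * c| = |(x + c) - (x - c)| := by ring_nf
      _ ≤ _ := abs_sub _ _
  have h3 : |x + c| ≤ |2 * c| + |x - c| := by
    calc |x + c| = |2 * c + (x - c)| := by ring_nf
      _ ≤ _ := abs_add_le _ _
  refine ⟨by linarith, by linarith, by linarith⟩

theorem nearDensity_map {a x z c α ε C Λ lam : ℝ} {P : Finset ℝ}
    (hR : 1 ≤ hilb P c) (hR' : 1 ≤ hilb P (a - c ^ 2))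
    (hΛ : Λ * hilb P c ≤ hilb P (a - c ^ 2) * (2 * |c|))
    (hα : 0 < α) (hC : 0 < C) (hε0 : 0 < ε) (hlam : 1 ≤ lam) (hlamε : 1 + ε ≤ lam * (1 - ε))
    (hΛ1 : 1 ≤ Λ) (hlamΛ : lam ^ 2 ≤ Λ ^ (0.4 : ℝ)) (hCΛ : hilb P (a - c ^ 2) + C ≤ Λ * C)
    (hx : |x - c| ≤ ε * |c|) (hz : |z - (a - x ^ 2)| ≤ α) :
    lam * nearDensity P C α c x ≤ nearDensity P C α (a - c ^ 2) z * (2 * |x|) := by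
  unfold nearDensity
  obtain ⟨b1, -, b3⟩ := abs_bounds_of_near hx
  have hz' := abs_sub_map_le (c := c) hz
  generalize hilb P c = R at *
  generalize hilb P (a - c ^ 2) = R' at *
  set ζ := (1 + ε) * (R' * (2 * |c|) / R) with hζ
  have hΛζ : Λ ≤ R' * (2 * |c|) / R := by rw [le_div_iff₀ (by linarith)]; exact hΛ
  have hζR : ζ * R = (1 + ε) * (R' * (2 * |c|)) := by rw [hζ]; field_simp
  have hζΛ : Λ ≤ ζ := by nlinarith
  have hζ0 : 0 < ζ := by linarith
  set T := R * |x - c| + C * α with hT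
  have hT0 : 0 < T := by positivity
  have hT' : R' * |z - (a - c ^ 2)| + C * α ≤ ζ * T := by
    have h1 : R' * |z - (a - c ^ 2)| ≤ R' * ((2 + ε) * |c| * |x - c| + α) := by
      gcongr
      refine hz'.trans ?_
      gcongr
    have h2 : ζ * T = (1 + ε) * (R' * (2 * |c|)) * |x - c| + ζ * (C * α) := by
      rw [← hζR, hT]; ring
    have h3 : Λ * (C * α) ≤ ζ * (C * α) := by gcongr
    have h4 : (R' + C) * α ≤ Λ * C * α := by gcongr
    have h5 : 0 ≤ ε * (R' * |c| * |x - c|) := by positivity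
    rw [h2]
    nlinarith
  have hT'0 : 0 < R' * |z - (a - c ^ 2)| + C * α := by positivity
  have p1 : (R' * |z - (a - c ^ 2)| + C * α) ^ (0.6 : ℝ) ≤ ζ ^ (0.6 : ℝ) * T ^ (0.6 : ℝ) := by
    rw [← Real.mul_rpow hζ0.le hT0.le]
    exact Real.rpow_le_rpow hT'0.le hT' (by norm_num)
  have p2 : lam ^ 2 * ζ ^ (0.6 : ℝ) ≤ ζ := by
    calc lam ^ 2 * ζ ^ (0.6 : ℝ) ≤ ζ ^ (0.4 : ℝ) * ζ ^ (0.6 : ℝ) := by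
          gcongr
          exact hlamΛ.trans (Real.rpow_le_rpow (by linarith) hζΛ (by norm_num))
      _ = ζ := by rw [← Real.rpow_add hζ0]; norm_num
  have p3 : lam * R * ζ ^ (0.6 : ℝ) ≤ R' * (2 * |x|) := by
    refine le_of_mul_le_mul_left ?_ (by linarith : 0 < lam)
    calc lam * (lam * R * ζ ^ (0.6 : ℝ)) = (lam ^ 2 * ζ ^ (0.6 : ℝ)) * R := by ring
      _ ≤ ζ * R := by gcongr
      _ = (1 + ε) * (R' * (2 * |c|)) := hζR
      _ ≤ lam * (1 - ε) * (R' * (2 * |c|)) := by gcongr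
      _ = lam * (R' * (2 * ((1 - ε) * |c|))) := by ring
      _ ≤ lam * (R' * (2 * |x|)) := by gcongr
  rw [← mul_div_assoc, div_mul_eq_mul_div, div_le_div_iff₀ (by positivity) (by positivity)]
  calc lam * R * (R' * |z - (a - c ^ 2)| + C * α) ^ (0.6 : ℝ)
      ≤ lam * R * (ζ ^ (0.6 : ℝ) * T ^ (0.6 : ℝ)) := by gcongr
    _ = lam * R * ζ ^ (0.6 : ℝ) * T ^ (0.6 : ℝ) := by ring
    _ ≤ R' * (2 * |x|) * T ^ (0.6 : ℝ) := by gcongr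

theorem nearDensity_map_le_hilb {a x z c α C A lam η : ℝ} {P : Finset ℝ}
    (hR : 1 ≤ hilb P c) (hc : c ≠ 0) (hcP : a - c ^ 2 ∈ P) (hα : 0 < α) (hC : 0 < C) (hA : 0 ≤ A)
    (hlam : lam ≤ 2) (hRC : hilb P c ≤ C * |c|)
    (hx : |x - c| ≤ 1 / 2 * |c|) (hxη : hilb P c * |x - c| ≤ η) (hCα : C * α ≤ η)
    (hη : A * (2 * η) ^ (0.4 : ℝ) ≤ 1 / 5)
    (hz : |z - (a - x ^ 2)| ≤ α) (hz2 : |z| < 2) (hzc : z ≠ a - c ^ 2) :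
    lam * (A * nearDensity P C α c x) ≤ hilb P z * (2 * |x|) := by
  unfold nearDensity
  obtain ⟨b1, -, b3⟩ := abs_bounds_of_near hx
  have hz' := abs_sub_map_le (c := c) hz
  have hS := inv_abs_sub_le_hilb hz2 hcP
  have hS0 : 0 < |z - (a - c ^ 2)| := abs_pos.2 (sub_ne_zero.2 hzc)
  have hc0 : 0 < |c| := abs_pos.2 hc
  generalize hilb P c = R at *
  set S := |z - (a - c ^ 2)| with hSdef
  set T := R * |x - c| + C * α with hT
  have hT0 : 0 < T := by positivity
  have p1 : A * T ^ (0.4 : ℝ) ≤ 1 / 5 := by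
    refine le_trans ?_ hη
    gcongr
    linarith
  have p2 : T ^ (0.4 : ℝ) * T ^ (0.6 : ℝ) = T := by
    rw [← Real.rpow_add hT0]; norm_num
  have p3 : lam * (A * (R / T ^ (0.6 : ℝ))) ≤ 2 / 5 * R / T := by
    have : R / T ^ (0.6 : ℝ) = R * T ^ (0.4 : ℝ) / T := by
      rw [div_eq_div_iff (by positivity) (by positivity), mul_assoc, p2]
    rw [this]
    calc lam * (A * (R * T ^ (0.4 : ℝ) / T)) = lam * (A * T ^ (0.4 : ℝ)) * (R / T) := by ring
      _ ≤ 2 * (1 / 5) * (R / T) := by gcongr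
      _ = _ := by ring
  refine p3.trans (le_trans ?_ (mul_le_mul_of_nonneg_right hS (by positivity)))
  rw [div_le_iff₀ hT0]
  have q1 : S ≤ 5 / 2 * |c| * |x - c| + α := by
    refine hz'.trans ?_
    have : |x + c| * |x - c| ≤ 5 / 2 * |c| * |x - c| := by gcongr; linarith
    linarith
  have q2 : 2 / 5 * R * S ≤ |c| * T := by
    have h1 : 2 / 5 * R * S ≤ 2 / 5 * R * (5 / 2 * |c| * |x - c| + α) := by gcongr
    have h2 : R * α ≤ C * |c| * α := by gcongr
    have h3 : 0 ≤ R * α := by positivity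
    rw [hT]
    nlinarith
  calc 2 / 5 * R = S⁻¹ * (2 / 5 * R * S) := by field_simp
    _ ≤ S⁻¹ * (|c| * T) := by gcongr
    _ ≤ S⁻¹ * (2 * |x| * T) := by gcongr; linarith
    _ = _ := by ring

/-- Uniform expansion of the Hilbert metric, stable under perturbation, away from the
post-critical set. -/
theorem IsPostcritical.exists_expansion_far {a β η : ℝ} {P : Finset ℝ} (hP : IsPostcritical a P)
    (hβ : β < 2) (hη : 0 < η) :
    ∃ κ > 1, ∃ α₁ > 0, ∀ x ∈ Icc (-β) β, ∀ z ∈ Icc (-β) β,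
      (∀ c ∈ P, η ≤ hilb P c * |x - c|) → (∀ c ∈ P, η ≤ hilb P c * |z - c|) →
      |z - (a - x ^ 2)| ≤ α₁ → κ * hilb P x ≤ hilb P z * (2 * |x|) := by
  set F : Set ℝ := {x | x ∈ Icc (-β) β ∧ ∀ c ∈ P, η ≤ hilb P c * |x - c|} with hF
  have hFc : IsCompact F := by
    refine (isCompact_Icc (a := -β) (b := β)).inter_right
      (t := {x | ∀ c ∈ P, η ≤ hilb P c * |x - c|}) ?_
    simp only [Set.ofPred_forall]
    refine isClosed_biInter fun c _ => isClosed_le (by fun_prop) (by fun_prop)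
  have hFsub : F ⊆ {x | |x| < 2 ∧ ∀ c ∈ P, x ≠ c} := by
    rintro x ⟨hx, hxc⟩
    refine ⟨(abs_le.2 hx).trans_lt hβ, ?_⟩
    rintro c hc rfl
    have := hxc x hc
    simp at this
    linarith
  have hcont := (continuousOn_hilb P).mono hFsub
  obtain ⟨U, hU⟩ := (hFc.image_of_continuousOn hcont).bddAbove
  have hUF : ∀ x ∈ F, hilb P x ≤ U := fun x hx => hU (mem_image_of_mem _ hx)
  set H : ℝ × ℝ → ℝ := fun q =>
    max (hilb P q.2 * (2 * |q.1|) - hilb P q.1) |q.2 - (a - q.1 ^ 2)| with hH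
  have hHc : ContinuousOn H (F ×ˢ F) := by
    have c1 : ContinuousOn (fun q : ℝ × ℝ => hilb P q.1) (F ×ˢ F) :=
      hcont.comp continuousOn_fst fun q hq => hq.1
    have c2 : ContinuousOn (fun q : ℝ × ℝ => hilb P q.2) (F ×ˢ F) :=
      hcont.comp continuousOn_snd fun q hq => hq.2
    exact ((c2.mul (by fun_prop)).sub c1).sup (by fun_prop)
  have hHpos : ∀ q ∈ F ×ˢ F, 0 < H q := by
    rintro ⟨x, z⟩ ⟨hx, hz⟩
    by_cases h : z = a - x ^ 2
    · refine lt_max_of_lt_left ?_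
      have hz2 := (hFsub hz).1
      have hx0 : x ≠ 0 := by
        rintro rfl
        exact (hFsub hz).2 a hP.mem (by simpa using h)
      dsimp only at hz2 ⊢
      rw [h] at hz2 ⊢
      have := hP.hilb_lt hx0 hz2
      rw [abs_mul, abs_two] at this
      linarith
    · exact lt_max_of_lt_right (abs_pos.2 (sub_ne_zero.2 h))
  obtain ⟨m, hm, hmH⟩ : ∃ m > 0, ∀ q ∈ F ×ˢ F, m ≤ H q := by
    rcases (F ×ˢ F).eq_empty_or_nonempty with he | hne
    · exact ⟨1, one_pos, by simp [he]⟩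
    · obtain ⟨q, hq, hmin⟩ := (hFc.prod hFc).exists_isMinOn hne hHc
      exact ⟨H q, hHpos q hq, fun q' hq' => hmin hq'⟩
  set V := max U 1 with hV
  have hV0 : 0 < V := lt_of_lt_of_le one_pos (le_max_right _ _)
  refine ⟨1 + m / V, by linarith [div_pos hm hV0], m / 2, by linarith, ?_⟩
  intro x hx z hz hxc hzc hxz
  have := hmH (x, z) ⟨⟨hx, hxc⟩, ⟨hz, hzc⟩⟩
  rcases le_max_iff.1 this with h | h
  · dsimp only at h
    have hxU : hilb P x ≤ V := (hUF x ⟨hx, hxc⟩).trans (le_max_left _ _)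
    have : m / V * hilb P x ≤ m := by
      calc m / V * hilb P x ≤ m / V * V := by gcongr
        _ = m := by field_simp
    linarith
  · dsimp only at h
    linarith

theorem IsPostcritical.eq_map_of_near {a x z c c' α s : ℝ} {P : Finset ℝ} (hP : IsPostcritical a P)
    (hs : ∀ c ∈ P, ∀ c' ∈ P, c ≠ c' → s ≤ |c - c'|) (hc : c ∈ P) (hc' : c' ∈ P) (hx : |x| ≤ 2)
    (hxc : |x - c| ≤ s / 16) (hzc : |z - c'| < s / 2) (hα : α ≤ s / 4)
    (hz : |z - (a - x ^ 2)| ≤ α) : c' = a - c ^ 2 := by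
  by_contra hne
  have h1 := hs _ hc' _ (hP.map_mem c hc) hne
  have h2 := abs_sub_map_le (c := c) hz
  have h3 : |x + c| ≤ 4 := (abs_add_le _ _).trans (by linarith [hP.abs_lt_two c hc])
  have h4 : |x + c| * |x - c| ≤ 4 * (s / 16) := by gcongr
  have h5 : |c' - (a - c ^ 2)| ≤ |z - c'| + |z - (a - c ^ 2)| := by
    calc |c' - (a - c ^ 2)| = |(z - (a - c ^ 2)) - (z - c')| := by ring_nf
      _ ≤ _ := by linarith [abs_sub (z - (a - c ^ 2)) (z - c')]
  linarith

theorem le_hilb_mul_map {a x z c α ε Λ lam η : ℝ} {P : Finset ℝ} (hR' : 1 ≤ hilb P (a - c ^ 2))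
    (hΛ : Λ * hilb P c ≤ hilb P (a - c ^ 2) * (2 * |c|)) (hε1 : ε ≤ 1) (hε0 : 0 ≤ ε) (hΛ0 : 0 ≤ Λ)
    (hlam : lam ≤ (1 - ε) * Λ) (hα : hilb P (a - c ^ 2) * α ≤ (lam - 1) * η) (hη : 0 ≤ η)
    (hx : |x - c| ≤ ε * |c|) (hxη : η ≤ hilb P c * |x - c|) (hz : |z - (a - x ^ 2)| ≤ α) :
    η ≤ hilb P (a - c ^ 2) * |z - (a - c ^ 2)| := by
  obtain ⟨-, b2, -⟩ := abs_bounds_of_near hx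
  have hz' := le_abs_sub_map (c := c) hz
  generalize hilb P c = R at *
  generalize hilb P (a - c ^ 2) = R' at *
  have h0 : 0 ≤ 1 - ε := by linarith
  have h1 : lam * η ≤ R' * (|x + c| * |x - c|) := by
    calc lam * η ≤ (1 - ε) * Λ * η := by gcongr
      _ ≤ (1 - ε) * Λ * (R * |x - c|) := by gcongr
      _ = (1 - ε) * (Λ * R) * |x - c| := by ring
      _ ≤ (1 - ε) * (R' * (2 * |c|)) * |x - c| := by gcongr
      _ ≤ R' * ((2 - ε) * |c|) * |x - c| := by
        have : 0 ≤ ε * (R' * |c| * |x - c|) := by positivity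
        nlinarith
      _ ≤ R' * |x + c| * |x - c| := by gcongr
      _ = _ := by ring
  have h2 : R' * (|x + c| * |x - c| - α) ≤ R' * |z - (a - c ^ 2)| := by gcongr
  nlinarith

theorem IsPostcritical.mul_le_nearDensity_map {a x z c α s k U C A lam η M : ℝ} {P : Finset ℝ}
    (hP : IsPostcritical a P) (hs : ∀ c ∈ P, ∀ c' ∈ P, c ≠ c' → s ≤ |c - c'|) (hc : c ∈ P)
    (hR : 1 ≤ hilb P c) (hRM : hilb P c ≤ M) (hC : 1 ≤ C) (hα : 0 < α) (hαs : α ≤ s / 4)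
    (hαx : α ^ (0.6 : ℝ) ≤ |x|) (hx : |x| ≤ 2) (hz : |z - (a - x ^ 2)| ≤ α)
    (hzc : |z - c| < s / 2) (hzη : hilb P c * |z - c| ≤ η) (hCα : C * α ≤ η) (hη : η ≤ 1 / 2)
    (hk : 0 ≤ k) (hks : k ≤ s / 8) (hkM : k * (3 * (M + C)) ≤ 1) (hA : 0 ≤ A) (hlam : lam ≤ 2)
    (hU : 0 ≤ U) (hUA : U ≤ A * k) :
    lam * U ≤ A * nearDensity P C α c z * (2 * |x|) := by
  unfold nearDensity
  have hx0 : 0 < |x| := (Real.rpow_pos_of_pos hα _).trans_le hαx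
  generalize hilb P c = R at *
  set T := R * |z - c| + C * α with hT
  have hT0 : 0 < T := by positivity
  have main : k * T ^ (0.6 : ℝ) ≤ |x| := by
    rcases eq_or_ne c a with rfl | hca
    · have h1 : T ≤ (M + C) * (x ^ 2 + α) := by
        have h2 : |z - c| ≤ x ^ 2 + α := by
          have := abs_sub_map_le (c := 0) hz
          simpa [← pow_two] using this
        have h3 : R * |z - c| ≤ M * (x ^ 2 + α) := by
          have : 0 ≤ M := by linarith
          gcongr
        have h4 : C * α ≤ C * (x ^ 2 + α) := by
          gcongr
          nlinarith [sq_nonneg x]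
        linarith
      have hMC : 1 ≤ M + C := by linarith
      have h5 : (x ^ 2 + α) ^ (0.6 : ℝ) ≤ 3 * |x| := by
        refine (Real.rpow_add_le_add_rpow (sq_nonneg x) hα.le (by norm_num) (by norm_num)).trans ?_
        have h6 : (x ^ 2) ^ (0.6 : ℝ) ≤ 2 * |x| := by
          calc (x ^ 2) ^ (0.6 : ℝ) = |x| ^ (0.2 : ℝ) * |x| := by
                rw [← sq_abs, ← Real.rpow_natCast, ← Real.rpow_mul (abs_nonneg x),
                  ← Real.rpow_add_one hx0.ne']
                norm_num
            _ ≤ 2 ^ (0.2 : ℝ) * |x| := by gcongr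
            _ ≤ 2 ^ (1 : ℝ) * |x| := by
              gcongr
              · norm_num
              · norm_num
            _ = 2 * |x| := by rw [Real.rpow_one]
        linarith
      have h7 : T ^ (0.6 : ℝ) ≤ (M + C) * (3 * |x|) := by
        calc T ^ (0.6 : ℝ) ≤ ((M + C) * (x ^ 2 + α)) ^ (0.6 : ℝ) := by gcongr
          _ = (M + C) ^ (0.6 : ℝ) * (x ^ 2 + α) ^ (0.6 : ℝ) :=
            Real.mul_rpow (by linarith) (by positivity)
          _ ≤ (M + C) ^ (1 : ℝ) * (3 * |x|) := by
            gcongr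
            norm_num
          _ = _ := by rw [Real.rpow_one]
      calc k * T ^ (0.6 : ℝ) ≤ k * ((M + C) * (3 * |x|)) := by gcongr
        _ = k * (3 * (M + C)) * |x| := by ring
        _ ≤ 1 * |x| := by gcongr
        _ = |x| := one_mul _
    · have h1 := hs a hP.mem c hc hca.symm
      have h2 : |a - c| ≤ |z - c| + |z - (a - x ^ 2)| + x ^ 2 := by
        calc |a - c| = |(z - c) - (z - (a - x ^ 2)) + x ^ 2| := by ring_nf
          _ ≤ |(z - c) - (z - (a - x ^ 2))| + |x ^ 2| := abs_add_le _ _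
          _ ≤ |z - c| + |z - (a - x ^ 2)| + |x ^ 2| := by gcongr; exact abs_sub _ _
          _ = _ := by rw [abs_of_nonneg (sq_nonneg x)]
      have h3 : x ^ 2 ≤ 2 * |x| := by rw [← sq_abs]; nlinarith
      have h4 : T ^ (0.6 : ℝ) ≤ 1 := Real.rpow_le_one hT0.le (by linarith) (by norm_num)
      calc k * T ^ (0.6 : ℝ) ≤ s / 8 * 1 := by gcongr; linarith
        _ ≤ |x| := by linarith
  have h1 : k ≤ R / T ^ (0.6 : ℝ) * |x| := by
    rw [div_mul_eq_mul_div, le_div_iff₀ (by positivity)]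
    nlinarith
  calc lam * U ≤ 2 * (A * k) := by gcongr
    _ ≤ 2 * (A * (R / T ^ (0.6 : ℝ) * |x|)) := by gcongr
    _ = _ := by ring

/-- `v` is at most `D` times the length of a unit vector at `x` in the singular metric given by
`A * nearDensity` near the post-critical set `P` and by `hilb` away from it. -/
def MetricDominates (P : Finset ℝ) (A C α η x D v : ℝ) : Prop :=
  (∀ c ∈ P, hilb P c * |x - c| < η → v ≤ D * (A * nearDensity P C α c x)) ∧
    ((∀ c ∈ P, η ≤ hilb P c * |x - c|) → v ≤ D * hilb P x)

theorem IsPostcritical.exists_metric_expansion {a β : ℝ} {P : Finset ℝ} (hP : IsPostcritical a P)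
    (hβ : β < 2) :
    ∃ lam A C η α₀ : ℝ, 1 < lam ∧ 1 ≤ A ∧ 1 ≤ C ∧ 0 < η ∧ η ≤ 1 / 2 ∧ (∀ c ∈ P, 2 * η ≤ |c|) ∧
      0 < α₀ ∧ ∀ α : ℝ, 0 < α → α < α₀ → C * α ≤ η ∧
        ∀ x ∈ Icc (-β) β, α ^ (0.6 : ℝ) ≤ |x| → ∀ z ∈ Icc (-β) β, |z - (a - x ^ 2)| ≤ α →
          ∀ D v : ℝ, 0 ≤ D → MetricDominates P A C α η x D v →
            MetricDominates P A C α η z (D * (2 * |x|)) (lam * v) := by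
  have hR1 : ∀ c ∈ P, 1 ≤ hilb P c := fun c hc => one_le_hilb (hP.abs_lt_two c hc)
  obtain ⟨cm, hcm0, hcm⟩ := P.exists_pos_forall_le (fun c => |c|) fun c hc =>
    abs_pos.2 (hP.ne_zero c hc)
  obtain ⟨s, hs0, hs'⟩ := P.offDiag.exists_pos_forall_le (fun q => |q.1 - q.2|) fun q hq =>
    abs_pos.2 (sub_ne_zero.2 (Finset.mem_offDiag.1 hq).2.2)
  have hs : ∀ c ∈ P, ∀ c' ∈ P, c ≠ c' → s ≤ |c - c'| := fun c hc c' hc' h =>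
    hs' (c, c') (Finset.mem_offDiag.2 ⟨hc, hc', h⟩)
  obtain ⟨M, hM⟩ := (P.image (hilb P)).exists_le
  replace hM : ∀ c ∈ P, hilb P c ≤ M := fun c hc => hM _ (Finset.mem_image_of_mem _ hc)
  have hM1 : 1 ≤ M := (hR1 a hP.mem).trans (hM a hP.mem)
  obtain ⟨Λ, hΛ1, hΛ⟩ : ∃ Λ > 1, ∀ c ∈ P, Λ * hilb P c ≤ hilb P (a - c ^ 2) * (2 * |c|) := by
    obtain ⟨m, hm, hmP⟩ := P.exists_pos_forall_le
      (fun c => hilb P (a - c ^ 2) * (2 * |c|) / hilb P c - 1) fun c hc => by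
        have h1 := hP.hilb_lt (hP.ne_zero c hc) (hP.abs_lt_two _ (hP.map_mem c hc))
        rw [abs_mul, abs_two] at h1
        have h2 : 0 < hilb P c := by linarith [hR1 c hc]
        rw [sub_pos, one_lt_div h2]
        exact h1
    refine ⟨1 + m, by linarith, fun c hc => ?_⟩
    rw [← le_div_iff₀ (by linarith [hR1 c hc])]
    linarith [hmP c hc]
  set lam₁ := min 2 (Λ ^ (0.2 : ℝ)) with hlam₁
  have hlam₁1 : 1 < lam₁ := lt_min (by norm_num) (Real.one_lt_rpow hΛ1 (by norm_num))
  have hlam₁2 : lam₁ ≤ 2 := min_le_left _ _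
  have hlam₁Λ : lam₁ ^ 2 ≤ Λ ^ (0.4 : ℝ) := by
    calc lam₁ ^ 2 ≤ (Λ ^ (0.2 : ℝ)) ^ 2 := by gcongr; exact min_le_right _ _
      _ = Λ ^ (0.4 : ℝ) := by
        rw [← Real.rpow_natCast, ← Real.rpow_mul (by linarith)]; norm_num
  have hlam₁Λ' : lam₁ ^ 2 ≤ Λ := by
    calc lam₁ ^ 2 ≤ Λ ^ (0.4 : ℝ) := hlam₁Λ
      _ ≤ Λ ^ (1 : ℝ) := Real.rpow_le_rpow_of_exponent_le hΛ1.le (by norm_num)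
      _ = Λ := Real.rpow_one _
  set ε := (lam₁ - 1) / (lam₁ + 1) with hε
  have hε0 : 0 < ε := div_pos (by linarith) (by linarith)
  have hεeq : ε * (lam₁ + 1) = lam₁ - 1 := by rw [hε]; field_simp
  have hε2 : ε ≤ 1 / 2 := by nlinarith
  have hlamε : 1 + ε ≤ lam₁ * (1 - ε) := by linarith
  have hlamε' : lam₁ ≤ (1 - ε) * Λ := by
    have : lam₁ * (1 - ε) * lam₁ ≤ (1 - ε) * Λ := by nlinarith
    nlinarith
  obtain ⟨C, hC1, hCΛ, hCcm⟩ : ∃ C ≥ 1, M ≤ C * (Λ - 1) ∧ M ≤ C * cm := by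
    have h1 : 0 < Λ - 1 := by linarith
    refine ⟨max 1 (max (M / (Λ - 1)) (M / cm)), le_max_left _ _, ?_, ?_⟩
    · rw [← div_le_iff₀ h1]
      exact (le_max_left _ _).trans (le_max_right _ _)
    · rw [← div_le_iff₀ hcm0]
      exact (le_max_right _ _).trans (le_max_right _ _)
  set r := min (min (ε * cm) (s / 16)) (2 - β) with hr
  have hr0 : 0 < r := lt_min (lt_min (by positivity) (by positivity)) (by linarith)
  have hrε : r ≤ ε * cm := (min_le_left _ _).trans (min_le_left _ _)
  have hrs : r ≤ s / 16 := (min_le_left _ _).trans (min_le_right _ _)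
  have hrβ : r ≤ 2 - β := min_le_right _ _
  set k := min (1 / (3 * (M + C))) (s / 8) with hk
  have hk0 : 0 < k := lt_min (by positivity) (by positivity)
  have hkM : k * (3 * (M + C)) ≤ 1 := by
    rw [← le_div_iff₀ (by positivity)]
    exact min_le_left _ _
  set A := max 1 (2 / r / k) with hA
  have hA1 : 1 ≤ A := le_max_left _ _
  have hA0 : 0 < A := by linarith
  have hAk : 2 / r ≤ A * k := by
    rw [← div_le_iff₀ hk0]
    exact le_max_right _ _
  set η := min (min r (1 / 2)) (min (cm / 2) ((1 / (5 * A)) ^ (2.5 : ℝ) / 2)) with hη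
  have hη0 : 0 < η := lt_min (lt_min hr0 (by norm_num)) (lt_min (by positivity) (by positivity))
  have hηr : η ≤ r := (min_le_left _ _).trans (min_le_left _ _)
  have hη2 : η ≤ 1 / 2 := (min_le_left _ _).trans (min_le_right _ _)
  have hηcm : η ≤ cm / 2 := (min_le_right _ _).trans (min_le_left _ _)
  have hηA : A * (2 * η) ^ (0.4 : ℝ) ≤ 1 / 5 := by
    have h1 : 2 * η ≤ (1 / (5 * A)) ^ (2.5 : ℝ) := by
      have : η ≤ (1 / (5 * A)) ^ (2.5 : ℝ) / 2 := (min_le_right _ _).trans (min_le_right _ _)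
      linarith
    calc A * (2 * η) ^ (0.4 : ℝ) ≤ A * ((1 / (5 * A)) ^ (2.5 : ℝ)) ^ (0.4 : ℝ) := by gcongr
      _ = A * (1 / (5 * A)) := by
        rw [← Real.rpow_mul (by positivity)]
        norm_num
      _ = 1 / 5 := by field_simp
  obtain ⟨κ, hκ, α₁, hα₁, hfar⟩ := hP.exists_expansion_far hβ hη0
  refine ⟨min lam₁ κ, A, C, η,
    min (min α₁ (η / C)) (min (s / 4) ((lam₁ - 1) * η / M)), lt_min hlam₁1 hκ, hA1, hC1, hη0, hη2,
    fun c hc => by linarith [hcm c hc], ?_, ?_⟩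
  · refine lt_min (lt_min hα₁ (by positivity)) (lt_min (by positivity) ?_)
    exact div_pos (mul_pos (by linarith) hη0) (by linarith)
  intro α hα hαlt
  simp only [lt_min_iff] at hαlt
  obtain ⟨⟨hαα₁, hαC⟩, hαs, hαM⟩ := hαlt
  rw [lt_div_iff₀ (by linarith)] at hαC hαM
  refine ⟨by linarith, ?_⟩
  intro x hx hαx z hz hxz D v hD hv
  have hx2 : |x| ≤ β := abs_le.2 hx
  have hz2 : |z| ≤ β := abs_le.2 hz
  have hMα : ∀ c ∈ P, hilb P c * α ≤ (lam₁ - 1) * η := fun c hc => by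
    have := mul_le_mul_of_nonneg_right (hM c hc) hα.le
    linarith
  have habs : ∀ c ∈ P, ∀ y, hilb P c * |y - c| < η → |y - c| < η := fun c hc y h => by
    have := mul_le_mul_of_nonneg_right (hR1 c hc) (abs_nonneg (y - c))
    linarith
  have hnear : ∀ c ∈ P, |x - c| ≤ r → |x - c| ≤ ε * |c| := fun c hc h =>
    h.trans (hrε.trans (by gcongr; exact hcm c hc))
  have conclude : ∀ ρ ρ' lam : ℝ, min lam₁ κ ≤ lam → 1 < lam → 0 ≤ ρ → v ≤ D * ρ →
      lam * ρ ≤ ρ' * (2 * |x|) → min lam₁ κ * v ≤ D * (2 * |x|) * ρ' := by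
    intro ρ ρ' lam h1 h2 h3 h4 h5
    have h0 : 0 ≤ min lam₁ κ := (lt_min (by linarith) (by linarith)).le
    calc min lam₁ κ * v ≤ min lam₁ κ * (D * ρ) := by gcongr
      _ ≤ lam * (D * ρ) := by gcongr
      _ = D * (lam * ρ) := by ring
      _ ≤ D * (ρ' * (2 * |x|)) := by gcongr
      _ = _ := by ring
  have hnd : ∀ c ∈ P, 0 ≤ A * nearDensity P C α c x := fun c hc => by
    have := hR1 c hc
    unfold nearDensity
    positivity
  by_cases hxfar : ∀ c ∈ P, η ≤ hilb P c * |x - c|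
  · have hvx := hv.2 hxfar
    have hRx : 1 ≤ hilb P x := one_le_hilb (by linarith)
    constructor
    · intro c' hc' hzc'
      have hzc'' := habs c' hc' z hzc'
      have hxr : ∀ c ∈ P, r ≤ |x - c| := by
        intro c hc
        by_contra! hlt
        have heq := hP.eq_map_of_near hs hc hc' (by linarith) (by linarith) (by linarith)
          hαs.le hxz
        subst heq
        have := le_hilb_mul_map (hR1 _ hc') (hΛ c hc) (by linarith) hε0.le (by linarith) hlamε'
          (hMα _ hc') hη0.le (hnear c hc hlt.le) (hxfar c hc) hxz
        linarith
      have hRU := hilb_le_two_div hr0 (by linarith) hxr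
      have := hP.mul_le_nearDensity_map (lam := lam₁) (U := 2 / r) hs hc' (hR1 _ hc') (hM _ hc')
        hC1 hα hαs.le hαx (by linarith) hxz (by linarith) hzc'.le (by linarith) hη2 hk0.le
        (min_le_right _ _) hkM hA0.le hlam₁2 (by positivity) hAk
      refine conclude _ _ lam₁ (min_le_left _ _) hlam₁1 (by positivity) hvx (le_trans ?_ this)
      gcongr
    · intro hzfar
      exact conclude _ _ κ (min_le_right _ _) hκ (by linarith) hvx
        (hfar x hx z hz hxfar hzfar (hxz.trans hαα₁.le))
  · push Not at hxfar
    obtain ⟨c, hc, hxc⟩ := hxfar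
    have hvx := hv.1 c hc hxc
    have hxc' := habs c hc x hxc
    have hfc := hP.map_mem c hc
    have hxε := hnear c hc (by linarith)
    constructor
    · intro c' hc' hzc'
      have heq := hP.eq_map_of_near hs hc hc' (by linarith) (by linarith)
        (by linarith [habs c' hc' z hzc']) hαs.le hxz
      subst heq
      refine conclude _ _ lam₁ (min_le_left _ _) hlam₁1 (hnd c hc) hvx ?_
      have := nearDensity_map (C := C) (hR1 c hc) (hR1 _ hfc) (hΛ c hc) hα (by linarith) hε0 hlam₁1.le
        hlamε
        hΛ1.le hlam₁Λ (by linarith [hM _ hfc]) hxε hxz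
      calc lam₁ * (A * nearDensity P C α c x) = A * (lam₁ * nearDensity P C α c x) := by ring
        _ ≤ A * (nearDensity P C α (a - c ^ 2) z * (2 * |x|)) := by gcongr
        _ = _ := by ring
    · intro hzfar
      refine conclude _ _ lam₁ (min_le_left _ _) hlam₁1 (hnd c hc) hvx ?_
      refine nearDensity_map_le_hilb (hR1 c hc) (hP.ne_zero c hc) hfc hα (by linarith) hA0.le hlam₁2
        ((hM c hc).trans (hCcm.trans ?_)) (hxε.trans ?_) hxc.le (by linarith) hηA hxz (by linarith)
        ?_
      · gcongr
        exact hcm c hc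
      · gcongr
      · rintro rfl
        have := hzfar _ hfc
        simp at this
        linarith

theorem MetricDominates.one_one {A C α η x : ℝ} {P : Finset ℝ} (hR : ∀ c ∈ P, 1 ≤ hilb P c)
    (hx : |x| < 2) (hA : 1 ≤ A) (hC : 1 ≤ C) (hα : 0 < α) (hη : η ≤ 1 / 2) (hCα : C * α ≤ η) :
    MetricDominates P A C α η x 1 1 := by
  refine ⟨fun c hc hxc => ?_, fun _ => by simpa using one_le_hilb hx⟩
  unfold nearDensity
  have hRc := hR c hc
  have hT0 : 0 < hilb P c * |x - c| + C * α := by positivity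
  have hT1 : (hilb P c * |x - c| + C * α) ^ (0.6 : ℝ) ≤ 1 :=
    Real.rpow_le_one hT0.le (by linarith) (by norm_num)
  have : 1 ≤ hilb P c / (hilb P c * |x - c| + C * α) ^ (0.6 : ℝ) := by
    rw [le_div_iff₀ (by positivity)]
    linarith
  nlinarith

theorem MetricDominates.le_of_lt {A C α η x D v β M U : ℝ} {P : Finset ℝ}
    (h : MetricDominates P A C α η x D v) (hR : ∀ c ∈ P, 1 ≤ hilb P c)
    (hM : ∀ c ∈ P, hilb P c ≤ M) (hM1 : 1 ≤ M) (hA : 1 ≤ A) (hC : 1 ≤ C) (hα : 0 < α)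
    (hα1 : α ≤ 1) (hη : 0 < η) (hP : ∀ c ∈ P, 2 * η ≤ |c|) (hβ : β < 2) (hx : |x| ≤ β)
    (hD : 0 ≤ D) (hUA : A * M ≤ U) (hUβ : 2 / min (η / M) (2 - β) ≤ U) :
    α ^ (0.6 : ℝ) * v ≤ D * U ∧ (|x| < η → v ≤ D * U) := by
  have hU0 : 0 < U := lt_of_lt_of_le (by positivity) hUA
  have hαp : α ^ (0.6 : ℝ) ≤ 1 := Real.rpow_le_one hα.le hα1 (by norm_num)
  have hα0 : 0 < α ^ (0.6 : ℝ) := Real.rpow_pos_of_pos hα _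
  have far : (∀ c ∈ P, η ≤ hilb P c * |x - c|) → v ≤ D * U := by
    intro hxc
    refine (h.2 hxc).trans ?_
    gcongr
    refine le_trans (hilb_le_two_div ?_ ?_ fun c hc => (min_le_left _ _).trans ?_) hUβ
    · exact lt_min (by positivity) (by linarith)
    · linarith [min_le_right (η / M) (2 - β)]
    · rw [div_le_iff₀ (by linarith)]
      have := mul_le_mul_of_nonneg_right (hM c hc) (abs_nonneg (x - c))
      linarith [hxc c hc]
  constructor
  · by_cases hxc : ∀ c ∈ P, η ≤ hilb P c * |x - c|
    · calc α ^ (0.6 : ℝ) * v ≤ α ^ (0.6 : ℝ) * (D * U) := by gcongr; exact far hxc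
        _ ≤ 1 * (D * U) := by gcongr
        _ = D * U := one_mul _
    · push Not at hxc
      obtain ⟨c, hc, hxc⟩ := hxc
      have hv := h.1 c hc hxc
      have hRc := hR c hc
      unfold nearDensity at hv
      have hαT : α ≤ hilb P c * |x - c| + C * α := by
        have : 0 ≤ hilb P c * |x - c| := by positivity
        nlinarith
      calc α ^ (0.6 : ℝ) * v
          ≤ α ^ (0.6 : ℝ) * (D * (A * (hilb P c / (hilb P c * |x - c| + C * α) ^ (0.6 : ℝ)))) := by
            gcongr
        _ ≤ α ^ (0.6 : ℝ) * (D * (A * (M / α ^ (0.6 : ℝ)))) := by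
          gcongr
          exact hM c hc
        _ = D * (A * M) := by field_simp
        _ ≤ D * U := by gcongr
  · intro hxη
    refine far fun c hc => ?_
    have h1 : |c| ≤ |x| + |x - c| := by
      calc |c| = |x - (x - c)| := by ring_nf
        _ ≤ _ := abs_sub _ _
    have h2 := mul_le_mul_of_nonneg_right (hR c hc) (abs_nonneg (x - c))
    linarith [hP c hc]

theorem StrictlyPreperiodic.exists_isPostcritical {a : ℝ} (h : StrictlyPreperiodic a) (h0 : 0 < a)
    (h2 : a < 2) : ∃ P, IsPostcritical a P := by
  obtain ⟨hne, m, p, hm, hp, hmp⟩ := h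
  have hmem : ∀ i, 1 ≤ i → |(qm a)^[i] 0| ≤ a := by
    intro i hi
    induction i, hi using Nat.le_induction with
    | base => simp [qm, abs_of_pos h0]
    | succ i hi ih =>
      rw [Function.iterate_succ_apply']
      have h3 := sq_abs ((qm a)^[i] 0)
      have h4 := abs_nonneg ((qm a)^[i] 0)
      simp only [qm] at *
      rw [abs_le]
      constructor <;> nlinarith
  refine ⟨(Finset.Icc 1 (m + p)).image fun i => (qm a)^[i] 0, h0, h2, ?_, ?_, ?_, ?_⟩
  · exact Finset.mem_image.2 ⟨1, Finset.mem_Icc.2 ⟨le_rfl, by omega⟩, by simp [qm]⟩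
  all_goals
    intro c hc
    obtain ⟨i, hi, rfl⟩ := Finset.mem_image.1 hc
    obtain ⟨hi1, hi2⟩ := Finset.mem_Icc.1 hi
  · change qm a _ ∈ _
    rw [← Function.iterate_succ_apply' (qm a)]
    rcases hi2.lt_or_eq with hlt | rfl
    · exact Finset.mem_image_of_mem _ (Finset.mem_Icc.2 ⟨by omega, hlt⟩)
    · rw [Function.iterate_succ_apply', hmp, ← Function.iterate_succ_apply' (qm a)]
      exact Finset.mem_image_of_mem _ (Finset.mem_Icc.2 ⟨by omega, by omega⟩)
  · exact hne i hi1
  · exact (hmem i hi1).trans_lt h2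

theorem fn_succ (a : ℝ) (d : ℕ) (φ : ℝ → ℝ) (α : ℝ) (n : ℕ) (θ x : ℝ) :
    fn a d φ α (n + 1) θ x = a - fn a d φ α n θ x ^ 2 + α * φ ((d : ℝ) ^ n * θ) := by
  have h1 : ∀ n, ((Viana a d φ α)^[n] (θ, x)).1 = (d : ℝ) ^ n * θ := by
    intro n
    induction n with
    | zero => simp
    | succ n ih =>
      rw [Function.iterate_succ_apply', Viana, ih]
      ring
  simp only [fn]
  rw [Function.iterate_succ_apply', ← h1 n]
  rfl

theorem hasDerivAt_fn (a : ℝ) (d : ℕ) (φ : ℝ → ℝ) (α : ℝ) (n : ℕ) (θ x : ℝ) :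
    HasDerivAt (fun y => fn a d φ α n θ y) (∏ j ∈ Finset.range n, (-2 * fn a d φ α j θ x)) x := by
  induction n with
  | zero => simpa [fn] using hasDerivAt_id' x
  | succ n ih =>
    simp only [fn_succ]
    refine (((ih.pow 2).const_sub a).add_const (α * φ ((d : ℝ) ^ n * θ))).congr_deriv ?_
    rw [Finset.prod_range_succ]
    push_cast
    ring

theorem abs_deriv_fn (a : ℝ) (d : ℕ) (φ : ℝ → ℝ) (α : ℝ) (n : ℕ) (θ x : ℝ) :
    |deriv (fun y => fn a d φ α n θ y) x| = ∏ j ∈ Finset.range n, (2 * |fn a d φ α j θ x|) := by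
  rw [(hasDerivAt_fn a d φ α n θ x).deriv, Finset.abs_prod]
  simp [abs_mul]

/-- building expansion. There are `λ > 1`, `K > 0`, `δ > 0` such that for
`α > 0` small enough: if `(θ,x) ∈ 𝕋 × B` and `|x₀|, …, |x_{n-1}| ≥ α^{0.6}` (where
`(θ_j, x_j) = F^j(θ,x)`, i.e. `x_j = f_j(θ,x)`), then `|∂f_n/∂x| ≥ K α^{0.6} λ^n`;
if moreover `|x_n| < δ`, then `|∂f_n/∂x| ≥ K λ^n`. -/
theorem building_expansion
    (a : ℝ) (ha : a ∈ Set.Ioo (1 : ℝ) 2) (hpre : StrictlyPreperiodic a)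
    (d : ℕ) (hd : 2 ≤ d)
    (φ : ℝ → ℝ) (hφa : ∀ x : ℝ, AnalyticAt ℝ φ x) (hφp : Function.Periodic φ 1)
    (hφnc : ∃ s t : ℝ, φ s ≠ φ t) (hφb : ∀ θ : ℝ, |φ θ| ≤ 1)
    (β : ℝ) (hβ1 : 1 < β) (hβ2 : β < |(-1 - Real.sqrt (1 + 4 * a)) / 2|)
    (hβmap : ∀ x ∈ Set.Icc (-β) β, qm a x ∈ Set.Ioo (-β) β)
    (hβder : ∀ x : ℝ, β ≤ |x| → 2 * β ≤ |deriv (qm a) x|)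
    :
    ∃ lam K δ : ℝ, 1 < lam ∧ 0 < K ∧ 0 < δ ∧
      ∃ α₀ > 0, ∀ α : ℝ, 0 < α → α < α₀ →
        ∀ θ x : ℝ, x ∈ Set.Icc (-β) β → ∀ n : ℕ,
          (∀ j : ℕ, j < n → α ^ (0.6 : ℝ) ≤ |fn a d φ α j θ x|) →
          K * α ^ (0.6 : ℝ) * lam ^ n ≤ |deriv (fun y => fn a d φ α n θ y) x| ∧
          (|fn a d φ α n θ x| < δ →
            K * lam ^ n ≤ |deriv (fun y => fn a d φ α n θ y) x|) := by
  obtain ⟨ha1, ha2⟩ := ha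
  obtain ⟨P, hP⟩ := hpre.exists_isPostcritical (by linarith) ha2
  have hβ : β < 2 := by
    have h1 : Real.sqrt (1 + 4 * a) < 3 := by
      rw [Real.sqrt_lt' (by norm_num)]
      linarith
    rw [abs_of_nonpos (by linarith [Real.sqrt_nonneg (1 + 4 * a)])] at hβ2
    linarith
  have hR1 : ∀ c ∈ P, 1 ≤ hilb P c := fun c hc => one_le_hilb (hP.abs_lt_two c hc)
  obtain ⟨M, hM⟩ := (P.image (hilb P)).exists_le
  replace hM : ∀ c ∈ P, hilb P c ≤ M := fun c hc => hM _ (Finset.mem_image_of_mem _ hc)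
  have hM1 : 1 ≤ M := (hR1 a hP.mem).trans (hM a hP.mem)
  obtain ⟨lam, A, C, η, α₀, hlam, hA, hC, hη0, hη, hηP, hα₀, hstep⟩ :=
    hP.exists_metric_expansion hβ
  have haβ : a < β := by
    have := (hβmap 0 ⟨by linarith, by linarith⟩).2
    simpa [qm] using this
  have hβa : -β < a - β ^ 2 := (hβmap β ⟨by linarith, le_rfl⟩).1
  set U := max (A * M) (2 / min (η / M) (2 - β)) with hU
  have hU0 : 0 < U := lt_of_lt_of_le (by positivity) (le_max_left _ _)
  refine ⟨lam, U⁻¹, η, hlam, by positivity, hη0, min α₀ (min (β - a) (a - β ^ 2 + β)),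
    lt_min hα₀ (lt_min (by linarith) (by linarith)), ?_⟩
  intro α hα hαlt θ x hx n hn
  simp only [lt_min_iff] at hαlt
  obtain ⟨hCα, hstep⟩ := hstep α hα hαlt.1
  have hpert : ∀ j, |fn a d φ α (j + 1) θ x - (a - fn a d φ α j θ x ^ 2)| ≤ α := by
    intro j
    rw [fn_succ, add_sub_cancel_left, abs_mul, abs_of_pos hα]
    exact mul_le_of_le_one_right hα.le (hφb _)
  have hB : ∀ j, fn a d φ α j θ x ∈ Set.Icc (-β) β := by
    intro j
    induction j with
    | zero => exact hx
    | succ j ih =>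
      obtain ⟨h1, h2⟩ := abs_le.1 (hpert j)
      have h3 : fn a d φ α j θ x ^ 2 ≤ β ^ 2 := sq_le_sq' ih.1 ih.2
      constructor <;> nlinarith [sq_nonneg (fn a d φ α j θ x)]
  have hdom : MetricDominates P A C α η (fn a d φ α n θ x)
      (∏ j ∈ Finset.range n, (2 * |fn a d φ α j θ x|)) (lam ^ n) := by
    induction n with
    | zero =>
      simpa using MetricDominates.one_one hR1 ((abs_le.2 (hB 0)).trans_lt hβ) hA hC hα hη hCα
    | succ n ih =>
      rw [Finset.prod_range_succ, pow_succ']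
      exact hstep _ (hB n) (hn n n.lt_succ_self) _ (hB (n + 1)) (hpert n) _ _
        (Finset.prod_nonneg fun _ _ => by positivity) (ih fun j hj => hn j (by omega))
  rw [abs_deriv_fn]
  obtain ⟨h1, h2⟩ := hdom.le_of_lt (β := β) hR1 hM hM1 hA hC hα (by nlinarith) hη0 hηP hβ
    (abs_le.2 (hB n)) (Finset.prod_nonneg fun _ _ => by positivity) (le_max_left _ _)
    (le_max_right _ _)
  refine ⟨?_, fun h => ?_⟩
  · rw [mul_assoc, inv_mul_le_iff₀ hU0, mul_comm U]
    exact h1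
  · rw [inv_mul_le_iff₀ hU0, mul_comm U]
    exact h2 h
end
end

section
/- There exist an integer l₀ ≥ 2 and constants A > μ > 0, depending only on φ and d, such that for every T ∈ 𝒯_φ and every θ ∈ [0,1]: A·d/2 ≥ ∑_{i=0}^{l₀+1} |T^{(i)}(θ)| ≥ ∑_{i=0}^{l₀} |T^{(i)}(θ)| ≥ 2dμ. Moreover, sup_{θ∈[0,1]} |T(θ)| ≥ 2μ. -/
open Set MeasureTheory Filter
open scoped ENNReal

noncomputable section

/-- The class `𝒯_φ`: functions of the form
`T(θ) = φ̂'((θ+k₁)/d) + ∑_{n≥1} aₙ φ̂'((θ+kₙ)/d^{n+1})` with `kₙ ∈ {0,…,dⁿ-1}` and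
`|aₙ| ≤ C₁ (R₁/d)ⁿ`. -/
def InT (d : ℕ) (C₁ R₁ : ℝ) (φ T : ℝ → ℝ) : Prop :=
  ∃ (b : ℕ → ℝ) (k : ℕ → ℕ),
    (∀ n : ℕ, 1 ≤ n → k n < d ^ n) ∧
    (∀ n : ℕ, 1 ≤ n → |b n| ≤ C₁ * (R₁ / d) ^ n) ∧
    ∀ θ : ℝ, T θ = deriv φ ((θ + (k 1 : ℝ)) / d) +
      ∑' n : ℕ, b (n + 1) * deriv φ ((θ + (k (n + 1) : ℝ)) / (d : ℝ) ^ (n + 2))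

section DerivativeBounds

open scoped Topology Nat NNReal ContDiff

/-- Near a point of analyticity, all iterated derivatives obey a common Cauchy-type bound. -/
theorem exists_eventually_iteratedDeriv_le_of_analyticAt {f : ℝ → ℝ} {x : ℝ}
    (hf : AnalyticAt ℝ f x) :
    ∃ C R : ℝ, 0 ≤ C ∧ 0 ≤ R ∧ ∀ᶠ y in 𝓝 x, ∀ k : ℕ, |iteratedDeriv k f y| ≤ C * k ! * R ^ k := by
  obtain ⟨p, r, hp⟩ := hf
  obtain ⟨s, hs0, hsr⟩ := ENNReal.lt_iff_exists_nnreal_btwn.1 hp.r_pos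
  have hs0 : 0 < s := by exact_mod_cast hs0
  set ρ : ℝ≥0 := s / 2 with hρ
  have hρ0 : 0 < ρ := by positivity
  have hρs : ρ + ρ = s := by simp [hρ]
  have hrad : ((ρ : ℝ≥0∞) + (ρ : ℝ≥0∞)) < p.radius := by
    have : ((ρ : ℝ≥0∞) + ρ) = s := by exact_mod_cast hρs
    rw [this]; exact hsr.trans_le hp.r_le
  have hsum := p.changeOriginSeries_summable_aux₁ hrad
  set S := ∑' s : Σ k l : ℕ, { s : Finset (Fin (k + l)) // s.card = l },
      ‖p (s.1 + s.2.1)‖₊ * ρ ^ s.2.1 * ρ ^ s.1 with hS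
  refine ⟨S, (ρ : ℝ)⁻¹, S.2, by positivity, ?_⟩
  filter_upwards [Metric.ball_mem_nhds x (show (0 : ℝ) < ρ from hρ0)] with y hy k
  have hyρ : ‖y - x‖₊ < ρ := by
    rw [Metric.mem_ball, dist_eq_norm] at hy; exact hy
  have hyr : (‖y - x‖₊ : ℝ≥0∞) < r := by
    refine lt_of_le_of_lt ?_ hsr
    have : ‖y - x‖₊ ≤ s := hyρ.le.trans (by rw [← hρs]; exact le_self_add)
    exact_mod_cast this
  have hq := hp.changeOrigin hyr
  rw [add_sub_cancel] at hq
  have h1 := hq.factorial_smul 1 k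
  rw [iteratedDeriv_eq_iteratedFDeriv, ← h1]
  have hle : ‖p.changeOrigin (y - x) k‖₊ * ρ ^ k ≤ S := by
    have hρrad : (ρ : ℝ≥0∞) < p.radius := lt_of_le_of_lt le_self_add hrad
    have e2 := p.changeOriginSeries_summable_aux₂ hρrad k
    calc ‖p.changeOrigin (y - x) k‖₊ * ρ ^ k
        ≤ (∑' s : Σ l : ℕ, { s : Finset (Fin (k + l)) // s.card = l },
            ‖p (k + s.1)‖₊ * ρ ^ s.1) * ρ ^ k := by
          gcongr
          refine (p.nnnorm_changeOrigin_le k (hyr.trans_le hp.r_le)).trans ?_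
          have hle : ∀ s : Σ l : ℕ, { s : Finset (Fin (k + l)) // s.card = l },
              ‖p (k + s.1)‖₊ * ‖y - x‖₊ ^ s.1 ≤ ‖p (k + s.1)‖₊ * ρ ^ s.1 := fun s => by gcongr
          exact (NNReal.summable_of_le hle e2).tsum_le_tsum hle e2
      _ = ∑' s : Σ l : ℕ, { s : Finset (Fin (k + l)) // s.card = l },
            ‖p (k + s.1)‖₊ * ρ ^ s.1 * ρ ^ k := (NNReal.tsum_mul_right _ _).symm
      _ ≤ S := by
          rw [hS, hsum.tsum_sigma' (NNReal.summable_sigma.1 hsum).1]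
          exact (NNReal.summable_sigma.1 hsum).2.le_tsum k (fun _ _ => zero_le)
  have hle' : ‖p.changeOrigin (y - x) k‖ * (ρ : ℝ) ^ k ≤ S := by exact_mod_cast hle
  have h2 : ‖p.changeOrigin (y - x) k fun _ => (1 : ℝ)‖ ≤ S * (ρ : ℝ)⁻¹ ^ k := by
    refine ((p.changeOrigin (y - x) k).le_opNorm _).trans ?_
    simp only [norm_one, Finset.prod_const_one, mul_one]
    rw [inv_pow, ← div_eq_mul_inv, le_div_iff₀ (by positivity)]
    exact hle'
  rw [nsmul_eq_mul, abs_mul, Nat.abs_cast]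
  rw [Real.norm_eq_abs] at h2
  calc (k ! : ℝ) * _ ≤ k ! * (S * (ρ : ℝ)⁻¹ ^ k) := by gcongr
    _ = _ := by ring

theorem Function.Periodic.iteratedDeriv {f : ℝ → ℝ} {c : ℝ} (hf : Function.Periodic f c) (k : ℕ) :
    Function.Periodic (iteratedDeriv k f) c := by
  intro x
  have h := congrFun (iteratedDeriv_comp_add_const k f c) x
  rw [← h, show (fun z => f (z + c)) = f from funext hf]

/-- A periodic real-analytic function obeys global Cauchy-type bounds. -/
theorem exists_iteratedDeriv_le_of_periodic {f : ℝ → ℝ} (hf : ∀ x, AnalyticAt ℝ f x)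
    (hp : Function.Periodic f 1) :
    ∃ C R : ℝ, 0 ≤ C ∧ 0 ≤ R ∧ ∀ (k : ℕ) (x : ℝ), |iteratedDeriv k f x| ≤ C * k ! * R ^ k := by
  have key : ∃ C R : ℝ, 0 ≤ C ∧ 0 ≤ R ∧
      ∀ y ∈ Icc (0 : ℝ) 1, ∀ k : ℕ, |iteratedDeriv k f y| ≤ C * k ! * R ^ k := by
    refine isCompact_Icc.induction_on (p := fun s => ∃ C R : ℝ, 0 ≤ C ∧ 0 ≤ R ∧
      ∀ y ∈ s, ∀ k : ℕ, |iteratedDeriv k f y| ≤ C * k ! * R ^ k) ?_ ?_ ?_ ?_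
    · exact ⟨0, 0, le_rfl, le_rfl, by simp⟩
    · rintro s t hst ⟨C, R, hC, hR, h⟩
      exact ⟨C, R, hC, hR, fun y hy => h y (hst hy)⟩
    · rintro s t ⟨C, R, hC, hR, h⟩ ⟨C', R', hC', hR', h'⟩
      refine ⟨max C C', max R R', le_max_of_le_left hC, le_max_of_le_left hR, ?_⟩
      rintro y (hy | hy) k
      · refine (h y hy k).trans ?_
        gcongr <;> exact le_max_left _ _
      · refine (h' y hy k).trans ?_
        gcongr <;> exact le_max_right _ _
    · intro x _
      obtain ⟨C, R, hC, hR, h⟩ := exists_eventually_iteratedDeriv_le_of_analyticAt (hf x)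
      exact ⟨_, mem_nhdsWithin_of_mem_nhds h, C, R, hC, hR, fun y hy => hy⟩
  obtain ⟨C, R, hC, hR, h⟩ := key
  refine ⟨C, R, hC, hR, fun k x => ?_⟩
  obtain ⟨y, hy, hxy⟩ := (hp.iteratedDeriv k).exists_mem_Ico₀ one_pos x
  rw [hxy]
  exact h y (Ico_subset_Icc_self hy) k

/-- If all derivatives of `f` vanish at a point and satisfy Cauchy-type bounds, then they vanish
in a neighbourhood of uniform size. -/
theorem eq_zero_of_iteratedDeriv_eq_zero_of_abs_sub_lt {f : ℝ → ℝ} (hf : ContDiff ℝ ∞ f)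
    {C R : ℝ} (hR : 0 < R) (hb : ∀ (k : ℕ) (x : ℝ), |iteratedDeriv k f x| ≤ C * k ! * R ^ k)
    {x₀ : ℝ} (h0 : ∀ k, iteratedDeriv k f x₀ = 0) {x : ℝ} (hx : |x - x₀| < R⁻¹) : f x = 0 := by
  rcases eq_or_ne x₀ x with rfl | hne
  · simpa using h0 0
  have hbound : ∀ n : ℕ, |f x| ≤ C * (R * |x - x₀|) ^ (n + 1) := by
    intro n
    obtain ⟨y, -, hy⟩ := taylor_mean_remainder_lagrange_iteratedDeriv (n := n) hne
      (hf.of_le (by exact_mod_cast le_top)).contDiffOn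
    have hz : taylorWithinEval f n (uIcc x₀ x) x₀ x = 0 := by
      rw [taylor_within_apply]
      refine Finset.sum_eq_zero fun k _ => ?_
      rw [iteratedDerivWithin_eq_iteratedDeriv (uniqueDiffOn_uIcc hne)
        (hf.of_le (by exact_mod_cast le_top)).contDiffAt left_mem_uIcc, h0, smul_zero]
    rw [hz, sub_zero] at hy
    rw [hy, abs_div, abs_mul, Nat.abs_cast, div_le_iff₀ (by positivity), abs_pow]
    calc _ ≤ C * (n + 1)! * R ^ (n + 1) * |x - x₀| ^ (n + 1) := by gcongr; exact hb _ _
      _ = _ := by rw [mul_pow]; ring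
  have hlt : R * |x - x₀| < 1 := by
    calc R * |x - x₀| < R * R⁻¹ := by gcongr
      _ = 1 := mul_inv_cancel₀ hR.ne'
  have hlim : Tendsto (fun n : ℕ => C * (R * |x - x₀|) ^ (n + 1)) atTop (𝓝 (C * 0)) :=
    ((tendsto_pow_atTop_nhds_zero_of_lt_one (by positivity) hlt).comp
      (tendsto_add_atTop_nat 1)).const_mul C
  rw [mul_zero] at hlim
  exact abs_nonpos_iff.1 (ge_of_tendsto' hlim hbound)

/-- Identity theorem for functions with global Cauchy-type bounds. -/
theorem eq_zero_of_iteratedDeriv_eq_zero {f : ℝ → ℝ} (hf : ContDiff ℝ ∞ f)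
    {C R : ℝ} (hR : 0 < R) (hb : ∀ (k : ℕ) (x : ℝ), |iteratedDeriv k f x| ≤ C * k ! * R ^ k)
    {x₀ : ℝ} (h0 : ∀ k, iteratedDeriv k f x₀ = 0) (x : ℝ) : f x = 0 := by
  set Z : Set ℝ := {y | ∀ k, iteratedDeriv k f y = 0} with hZ
  have hclosed : IsClosed Z := by
    rw [hZ, Set.ofPred_forall]
    exact isClosed_iInter fun k =>
      isClosed_eq (hf.continuous_iteratedDeriv k (by exact_mod_cast le_top)) continuous_const
  have hopen : IsOpen Z := by
    rw [isOpen_iff_mem_nhds]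
    intro y hy
    have hev : ∀ᶠ z in 𝓝 y, f z = 0 := by
      filter_upwards [Metric.ball_mem_nhds y (inv_pos.2 hR)] with z hz
      rw [Metric.mem_ball, Real.dist_eq] at hz
      exact eq_zero_of_iteratedDeriv_eq_zero_of_abs_sub_lt hf hR hb hy hz
    filter_upwards [hev.eventually_nhds] with z hz k
    have : f =ᶠ[𝓝 z] fun _ => 0 := hz
    rw [this.iteratedDeriv_eq k, iteratedDeriv_const, ite_self]
  have huniv : Z = univ := IsClopen.eq_univ ⟨hclosed, hopen⟩ ⟨x₀, h0⟩
  have hx : x ∈ Z := huniv ▸ mem_univ x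
  simpa using hx 0

/-- A smooth periodic function some positive-order derivative of which vanishes identically is
constant. -/
theorem deriv_eq_zero_of_periodic_of_iteratedDeriv_eq_zero {f : ℝ → ℝ} (hf : ContDiff ℝ ∞ f)
    (hp : Function.Periodic f 1) (n : ℕ) (h : ∀ x, iteratedDeriv (n + 1) f x = 0) (x : ℝ) :
    deriv f x = 0 := by
  induction n generalizing x with
  | zero => simpa using h x
  | succ n ih =>
    refine ih (fun x => ?_) x
    have hdiff : ∀ m, Differentiable ℝ (iteratedDeriv m f) := fun m =>
      hf.differentiable_iteratedDeriv m (by exact_mod_cast WithTop.coe_lt_top _)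
    have hconst : ∀ y z, iteratedDeriv (n + 1) f y = iteratedDeriv (n + 1) f z :=
      is_const_of_deriv_eq_zero (hdiff _) fun y => by rw [← iteratedDeriv_succ]; exact h y
    obtain ⟨c, -, hc⟩ := exists_deriv_eq_zero (f := iteratedDeriv n f) zero_lt_one
      (hdiff n).continuous.continuousOn (by simpa using (hp.iteratedDeriv n 0).symm)
    rw [hconst x c, iteratedDeriv_succ, hc]

/-- On a compact space, finitely many members of a family of continuous functions without common
zero already have no common zero, quantitatively. -/
theorem exists_finset_pos_le_sum_abs {X ι : Type*} [TopologicalSpace X] [CompactSpace X]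
    {s : ι → X → ℝ} (hs : ∀ i, Continuous (s i)) (h : ∀ x, ∃ i, s i x ≠ 0) :
    ∃ (F : Finset ι) (m : ℝ), 0 < m ∧ ∀ x, m ≤ ∑ i ∈ F, |s i x| := by
  obtain ⟨F, hF⟩ := isCompact_univ.elim_finite_subcover (fun i => {x | s i x ≠ 0})
    (fun i => isOpen_ne_fun (hs i) continuous_const) fun x _ => mem_iUnion.2 (h x)
  refine ⟨F, ?_⟩
  have hcont : Continuous fun x => ∑ i ∈ F, |s i x| := by fun_prop
  have hpos : ∀ x, 0 < ∑ i ∈ F, |s i x| := fun x => by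
    obtain ⟨i, hi, hx⟩ := mem_iUnion₂.1 (hF (mem_univ x))
    exact Finset.sum_pos' (fun _ _ => abs_nonneg _) ⟨i, hi, abs_pos.2 hx⟩
  rcases isEmpty_or_nonempty X with hX | hX
  · exact ⟨1, one_pos, fun x => hX.elim x⟩
  · obtain ⟨x₀, -, hx₀⟩ := isCompact_univ.exists_isMinOn univ_nonempty hcont.continuousOn
    exact ⟨_, hpos x₀, fun x => hx₀ (mem_univ x)⟩

/-- The `j`-th derivative of `θ ↦ f'((θ + κ₀)/D) + ∑ₙ bₙ f'((θ + κₙ)/D^(n+2))`, computed term by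
term. -/
def shiftSeries (D : ℝ) (f : ℝ → ℝ) (j : ℕ) (b κ : ℕ → ℝ) (θ : ℝ) : ℝ :=
  iteratedDeriv (j + 1) f ((θ + κ 0) / D) / D ^ j +
    ∑' n, b n * (iteratedDeriv (j + 1) f ((θ + κ n) / D ^ (n + 2)) / (D ^ (n + 2)) ^ j)

theorem norm_shiftSeries_term_le {D M : ℝ} (hD : 1 ≤ D) {f : ℝ → ℝ} {j : ℕ}
    (hM : ∀ x, |iteratedDeriv (j + 1) f x| ≤ M) {b c : ℕ → ℝ} (hb : ∀ n, |b n| ≤ c n)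
    (n : ℕ) (y : ℝ) :
    ‖b n * (iteratedDeriv (j + 1) f y / (D ^ (n + 2)) ^ j)‖ ≤ c n * M := by
  have hpow : (1 : ℝ) ≤ (D ^ (n + 2)) ^ j := one_le_pow₀ (one_le_pow₀ hD)
  rw [Real.norm_eq_abs, abs_mul, abs_div, abs_of_pos (zero_lt_one.trans_le hpow)]
  refine mul_le_mul (hb n) ?_ (by positivity) ((abs_nonneg _).trans (hb n))
  exact (div_le_self (abs_nonneg _) hpow).trans (hM y)

theorem abs_shiftSeries_le {D M : ℝ} (hD : 1 ≤ D) {f : ℝ → ℝ} {j : ℕ}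
    (hM : ∀ x, |iteratedDeriv (j + 1) f x| ≤ M) {b c : ℕ → ℝ} (hc : Summable c)
    (hb : ∀ n, |b n| ≤ c n) (κ : ℕ → ℝ) (θ : ℝ) :
    |shiftSeries D f j b κ θ| ≤ (1 + ∑' n, c n) * M := by
  have hpow : (1 : ℝ) ≤ D ^ j := one_le_pow₀ hD
  rw [shiftSeries, add_mul, one_mul]
  refine (abs_add_le _ _).trans (add_le_add ?_ ?_)
  · rw [abs_div, abs_of_pos (zero_lt_one.trans_le hpow)]
    exact (div_le_self (abs_nonneg _) hpow).trans (hM _)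
  · exact tsum_of_norm_bounded (hc.hasSum.mul_right M)
      fun n => norm_shiftSeries_term_le hD hM hb n _

theorem continuous_shiftSeries {X : Type*} [TopologicalSpace X] {D M : ℝ} (hD : 1 ≤ D)
    {f : ℝ → ℝ} (hf : ContDiff ℝ ∞ f) {j : ℕ} (hM : ∀ x, |iteratedDeriv (j + 1) f x| ≤ M)
    {c : ℕ → ℝ} (hc : Summable c) {b κ : X → ℕ → ℝ} {θ : X → ℝ} (hb : ∀ x n, |b x n| ≤ c n)
    (hbc : Continuous b) (hκ : Continuous κ) (hθ : Continuous θ) :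
    Continuous fun x => shiftSeries D f j (b x) (κ x) (θ x) := by
  have hg : Continuous (iteratedDeriv (j + 1) f) :=
    hf.continuous_iteratedDeriv _ (by exact_mod_cast le_top)
  have hbn : ∀ n, Continuous fun x => b x n := fun n => (continuous_apply n).comp hbc
  have hκn : ∀ n, Continuous fun x => κ x n := fun n => (continuous_apply n).comp hκ
  unfold shiftSeries
  refine Continuous.add ?_ (continuous_tsum (fun n => ?_) (hc.mul_right M)
    fun n x => norm_shiftSeries_term_le hD hM (hb x) n _)
  · exact (hg.comp ((hθ.add (hκn 0)).div_const _)).div_const _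
  · exact (hbn n).mul ((hg.comp ((hθ.add (hκn n)).div_const _)).div_const _)

theorem hasDerivAt_shiftSeries {D : ℝ} (hD : 1 ≤ D) {f : ℝ → ℝ} (hf : ContDiff ℝ ∞ f)
    (hM : ∀ j, ∃ M, ∀ x, |iteratedDeriv j f x| ≤ M) {b c : ℕ → ℝ} (hc : Summable c)
    (hb : ∀ n, |b n| ≤ c n) (κ : ℕ → ℝ) (j : ℕ) (θ : ℝ) :
    HasDerivAt (shiftSeries D f j b κ) (shiftSeries D f (j + 1) b κ θ) θ := by
  have hstep : ∀ (E s y : ℝ), HasDerivAt (fun y => iteratedDeriv (j + 1) f ((y + s) / E) / E ^ j)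
      (iteratedDeriv (j + 1 + 1) f ((y + s) / E) / E ^ (j + 1)) y := by
    intro E s y
    have h1 : HasDerivAt (iteratedDeriv (j + 1) f) (iteratedDeriv (j + 1 + 1) f ((y + s) / E))
        ((y + s) / E) := by
      rw [iteratedDeriv_succ (n := j + 1)]
      exact (hf.differentiable_iteratedDeriv (j + 1)
        (by exact_mod_cast WithTop.coe_lt_top _)).differentiableAt.hasDerivAt
    have h2 : HasDerivAt (fun y : ℝ => (y + s) / E) (1 / E) y :=
      ((hasDerivAt_id y).add_const s).div_const E
    refine ((h1.comp y h2).div_const (E ^ j)).congr_deriv ?_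
    rw [mul_one_div, div_div, pow_succ']
  obtain ⟨M, hM1⟩ := hM (j + 1)
  obtain ⟨M', hM2⟩ := hM (j + 1 + 1)
  refine (hstep D (κ 0) θ).add (hasDerivAt_tsum (hc.mul_right M')
    (fun n y => (hstep (D ^ (n + 2)) (κ n) y).const_mul (b n))
    (fun n y => norm_shiftSeries_term_le hD hM2 hb n _) (y₀ := 0) ?_ θ)
  exact Summable.of_norm_bounded (hc.mul_right M) fun n => norm_shiftSeries_term_le hD hM1 hb n _

theorem iteratedDeriv_shiftSeries {D : ℝ} (hD : 1 ≤ D) {f : ℝ → ℝ} (hf : ContDiff ℝ ∞ f)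
    (hM : ∀ j, ∃ M, ∀ x, |iteratedDeriv j f x| ≤ M) {b c : ℕ → ℝ} (hc : Summable c)
    (hb : ∀ n, |b n| ≤ c n) (κ : ℕ → ℝ) (j : ℕ) :
    iteratedDeriv j (shiftSeries D f 0 b κ) = shiftSeries D f j b κ := by
  induction j with
  | zero => exact iteratedDeriv_zero
  | succ j ih =>
    rw [iteratedDeriv_succ, ih]
    exact funext fun θ => (hasDerivAt_shiftSeries hD hf hM hc hb κ j θ).deriv

theorem contDiff_shiftSeries {D : ℝ} (hD : 1 ≤ D) {f : ℝ → ℝ} (hf : ContDiff ℝ ∞ f)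
    (hM : ∀ j, ∃ M, ∀ x, |iteratedDeriv j f x| ≤ M) {b c : ℕ → ℝ} (hc : Summable c)
    (hb : ∀ n, |b n| ≤ c n) (κ : ℕ → ℝ) : ContDiff ℝ ∞ (shiftSeries D f 0 b κ) := by
  refine contDiff_of_differentiable_iteratedDeriv fun j _ => ?_
  rw [iteratedDeriv_shiftSeries hD hf hM hc hb]
  exact fun θ => (hasDerivAt_shiftSeries hD hf hM hc hb κ j θ).differentiableAt

/-- A series `shiftSeries D f 0 b κ` built from a nonconstant periodic function does not vanish
identically: in its high derivatives the first term dominates the sum of all others. -/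
theorem shiftSeries_ne_zero {D : ℝ} (hD : 1 < D) {f : ℝ → ℝ} (hf : ContDiff ℝ ∞ f)
    (hp : Function.Periodic f 1) (hnc : ∃ s t, f s ≠ f t)
    (hM : ∀ j, ∃ M, ∀ x, |iteratedDeriv j f x| ≤ M) {b c : ℕ → ℝ} (hc : Summable c)
    (hb : ∀ n, |b n| ≤ c n) (κ : ℕ → ℝ) : ∃ θ, shiftSeries D f 0 b κ θ ≠ 0 := by
  by_contra! hzero
  have hD0 : 0 < D := one_pos.trans hD
  have hall : ∀ j θ, shiftSeries D f j b κ θ = 0 := fun j θ => by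
    rw [← iteratedDeriv_shiftSeries hD.le hf hM hc hb,
      show shiftSeries D f 0 b κ = fun _ => 0 from funext hzero, iteratedDeriv_const, ite_self]
  obtain ⟨l, hl⟩ := pow_unbounded_of_one_lt (∑' n, c n) hD
  set g := iteratedDeriv (l + 1) f with hg
  have hgc : Continuous g := hf.continuous_iteratedDeriv _ (by exact_mod_cast le_top)
  obtain ⟨x, -, hx⟩ := isCompact_Icc.exists_isMaxOn (nonempty_Icc.2 zero_le_one)
    (hgc.abs.continuousOn (s := Icc (0 : ℝ) 1))
  have hmax : ∀ y, |g y| ≤ |g x| := fun y => by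
    obtain ⟨z, hz, hyz⟩ := (hp.iteratedDeriv (l + 1)).exists_mem_Ico₀ one_pos y
    rw [hg, hyz]
    exact hx (Ico_subset_Icc_self hz)
  have hterm : ∀ n y, ‖b n * (g y / (D ^ (n + 2)) ^ l)‖ ≤ c n * (|g x| / (D ^ l * D ^ l)) := by
    intro n y
    rw [Real.norm_eq_abs, abs_mul, abs_div, abs_of_pos (by positivity : 0 < (D ^ (n + 2)) ^ l)]
    refine mul_le_mul (hb n) ?_ (by positivity) ((abs_nonneg _).trans (hb n))
    refine div_le_div₀ (abs_nonneg _) (hmax y) (by positivity) ?_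
    rw [← mul_pow, ← pow_two]
    exact pow_le_pow_left₀ (by positivity) (pow_le_pow_right₀ hD.le (by lia)) l
  have hmain := hall l (D * x - κ 0)
  rw [shiftSeries, sub_add_cancel, mul_div_cancel_left₀ _ hD0.ne', ← hg] at hmain
  have hle : |g x| / D ^ l ≤ (∑' n, c n) * (|g x| / (D ^ l * D ^ l)) := by
    have h := tsum_of_norm_bounded (hc.hasSum.mul_right (|g x| / (D ^ l * D ^ l)))
      fun n => hterm n ((D * x - κ 0 + κ n) / D ^ (n + 2))
    rw [← neg_eq_of_add_eq_zero_right hmain, norm_neg, norm_div, Real.norm_eq_abs,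
      Real.norm_of_nonneg (by positivity)] at h
    exact h
  have hpos : 0 < D ^ l := by positivity
  have hgx : g x = 0 := by
    by_contra hne
    have habs : 0 < |g x| / (D ^ l * D ^ l) := by positivity
    have heq : |g x| / D ^ l = D ^ l * (|g x| / (D ^ l * D ^ l)) := by field_simp
    rw [heq] at hle
    exact absurd (le_of_mul_le_mul_right hle habs) (not_le.2 hl)
  have hgz : ∀ y, g y = 0 := fun y => by
    have h := hmax y
    rw [hgx, abs_zero] at h
    exact abs_nonpos_iff.1 h
  obtain ⟨s, t, hst⟩ := hnc
  exact hst (is_const_of_deriv_eq_zero (hf.differentiable (by simp))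
    (deriv_eq_zero_of_periodic_of_iteratedDeriv_eq_zero hf hp l hgz) s t)

theorem exists_shiftSeries_ne_zero {D : ℝ} (hD : 1 < D) {f : ℝ → ℝ} (hf : ContDiff ℝ ∞ f)
    (hp : Function.Periodic f 1) (hnc : ∃ s t, f s ≠ f t) {C R : ℝ} (hC : 0 ≤ C) (hR : 0 ≤ R)
    (hM : ∀ (k : ℕ) (x : ℝ), |iteratedDeriv k f x| ≤ C * k ! * R ^ k) {b c : ℕ → ℝ}
    (hc : Summable c) (hb : ∀ n, |b n| ≤ c n) (κ : ℕ → ℝ) (θ : ℝ) :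
    ∃ j, shiftSeries D f j b κ θ ≠ 0 := by
  by_contra! hzero
  have hM' : ∀ j, ∃ M, ∀ x, |iteratedDeriv j f x| ≤ M := fun j => ⟨_, hM j⟩
  have hc0 : 0 ≤ ∑' n, c n := tsum_nonneg fun n => (abs_nonneg _).trans (hb n)
  obtain ⟨x, hx⟩ := shiftSeries_ne_zero hD hf hp hnc hM' hc hb κ
  refine hx (eq_zero_of_iteratedDeriv_eq_zero (contDiff_shiftSeries hD.le hf hM' hc hb κ)
    (C := (1 + ∑' n, c n) * C * (R + 1)) (R := 2 * (R + 1)) (by positivity) ?_ (x₀ := θ) ?_ x)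
  · intro k y
    rw [iteratedDeriv_shiftSeries hD.le hf hM' hc hb]
    refine (abs_shiftSeries_le hD.le (hM (k + 1)) hc hb κ y).trans ?_
    have hk : ((k : ℝ) + 1) ≤ 2 ^ k := by exact_mod_cast Nat.lt_two_pow_self
    calc (1 + ∑' n, c n) * (C * (k + 1)! * R ^ (k + 1))
        = (1 + ∑' n, c n) * (C * ((k + 1) * k !) * R ^ (k + 1)) := by
          rw [Nat.factorial_succ]; push_cast; ring
      _ ≤ (1 + ∑' n, c n) * (C * (2 ^ k * k !) * (R + 1) ^ (k + 1)) := by gcongr; linarith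
      _ = _ := by rw [mul_pow]; ring
  · intro k
    rw [iteratedDeriv_shiftSeries hD.le hf hM' hc hb, hzero]

end DerivativeBounds

/-- Lemma on the class `𝒯_φ`. There are `l₀ ≥ 2` and `A > μ > 0`, depending
only on `φ` and `d`, such that for every `T ∈ 𝒯_φ` and `θ ∈ [0,1]`:
`A d / 2 ≥ ∑_{i=0}^{l₀+1} |T^{(i)}(θ)| ≥ ∑_{i=0}^{l₀} |T^{(i)}(θ)| ≥ 2 d μ`;
moreover `sup_{θ∈[0,1]} |T(θ)| ≥ 2μ`. -/
theorem tclass_uniform_bounds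
    (a : ℝ) (ha : a ∈ Set.Ioo (1 : ℝ) 2) (hpre : StrictlyPreperiodic a)
    (d : ℕ) (hd : 2 ≤ d)
    (φ : ℝ → ℝ) (hφa : ∀ x : ℝ, AnalyticAt ℝ φ x) (hφp : Function.Periodic φ 1)
    (hφnc : ∃ s t : ℝ, φ s ≠ φ t) (hφb : ∀ θ : ℝ, |φ θ| ≤ 1)
    (C₁ R₁ : ℝ) (hC₁ : 0 < C₁) (hR₁ : R₁ ∈ Set.Ioo (0 : ℝ) 2) :
    ∃ l₀ : ℕ, 2 ≤ l₀ ∧ ∃ A μ : ℝ, 0 < μ ∧ μ < A ∧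
      ∀ T : ℝ → ℝ, InT d C₁ R₁ φ T →
        (∀ θ ∈ Set.Icc (0 : ℝ) 1,
          (∑ i ∈ Finset.range (l₀ + 2), |iteratedDeriv i T θ|) ≤ A * d / 2 ∧
          (∑ i ∈ Finset.range (l₀ + 1), |iteratedDeriv i T θ|) ≤
            (∑ i ∈ Finset.range (l₀ + 2), |iteratedDeriv i T θ|) ∧
          2 * d * μ ≤ ∑ i ∈ Finset.range (l₀ + 1), |iteratedDeriv i T θ|) ∧
        2 * μ ≤ ⨆ θ : Set.Icc (0 : ℝ) 1, |T (θ : ℝ)| := by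
  have hD2 : (2 : ℝ) ≤ d := by exact_mod_cast hd
  have hD : (1 : ℝ) < d := by linarith
  have hD0 : (0 : ℝ) < d := by linarith
  have hf : ContDiff ℝ (↑(⊤ : ℕ∞)) φ := contDiff_iff_contDiffAt.2 fun x => (hφa x).contDiffAt
  obtain ⟨C, R, hC, hR, hCR⟩ := exists_iteratedDeriv_le_of_periodic hφa hφp
  have hM : ∀ j, ∃ M, ∀ x, |iteratedDeriv j φ x| ≤ M := fun j => ⟨_, hCR j⟩
  set c : ℕ → ℝ := fun n => C₁ * (R₁ / d) ^ (n + 1) with hcdef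
  have hc : Summable c := by
    refine Summable.mul_left _ ((summable_nat_add_iff 1).2
      (summable_geometric_of_lt_one (div_nonneg hR₁.1.le hD0.le) ?_))
    rw [div_lt_one hD0]
    exact hR₁.2.trans_le hD2
  set K : Set ((ℕ → ℝ) × (ℕ → ℝ)) :=
    (univ.pi fun n => Icc (-c n) (c n)) ×ˢ (univ.pi fun n => Icc 0 ((d : ℝ) ^ (n + 1))) with hK
  have hKc : IsCompact K :=
    (isCompact_univ_pi fun _ => isCompact_Icc).prod (isCompact_univ_pi fun _ => isCompact_Icc)
  have hKb : ∀ (p : K) n, |p.1.1 n| ≤ c n := fun p n => abs_le.2 (p.2.1 n (mem_univ n))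
  have : CompactSpace K := isCompact_iff_compactSpace.1 hKc
  obtain ⟨F, m, hm, hF⟩ := exists_finset_pos_le_sum_abs (X := K × Icc (0 : ℝ) 1)
    (s := fun j x => shiftSeries d φ j x.1.1.1 x.1.1.2 x.2)
    (fun j => continuous_shiftSeries hD.le hf (hCR (j + 1)) hc (fun x => hKb x.1)
      (by fun_prop) (by fun_prop) (by fun_prop))
    (fun x => exists_shiftSeries_ne_zero hD hf hφp hφnc hC hR hCR hc (hKb x.1) _ _)
  obtain ⟨F', m', hm', hF'⟩ := exists_finset_pos_le_sum_abs (X := K)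
    (s := fun (θ : Icc (0 : ℝ) 1) x => shiftSeries d φ 0 x.1.1 x.1.2 θ)
    (fun θ => continuous_shiftSeries hD.le hf (hCR 1) hc hKb
      (by fun_prop) (by fun_prop) (by fun_prop))
    (fun x => by
      by_contra! hzero
      have hsmooth := contDiff_shiftSeries hD.le hf hM hc (hKb x) x.1.2
      have hnear : shiftSeries d φ 0 x.1.1 x.1.2 =ᶠ[nhds (1 / 2)] fun _ => 0 := by
        filter_upwards [Icc_mem_nhds (show (0 : ℝ) < 1 / 2 by norm_num)
          (show (1 / 2 : ℝ) < 1 by norm_num)] with θ hθ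
        exact hzero ⟨θ, hθ⟩
      obtain ⟨j, hj⟩ := exists_shiftSeries_ne_zero hD hf hφp hφnc hC hR hCR hc (hKb x) x.1.2 (1 / 2)
      rw [← iteratedDeriv_shiftSeries hD.le hf hM hc (hKb x), hnear.iteratedDeriv_eq j,
        iteratedDeriv_const, ite_self] at hj
      exact hj rfl)
  set l₀ := max 2 (F.sup id) with hl₀
  have hc0 : 0 ≤ ∑' n, c n := tsum_nonneg fun n =>
    mul_nonneg hC₁.le (pow_nonneg (div_nonneg hR₁.1.le hD0.le) _)
  set B : ℕ → ℝ := fun j => (1 + ∑' n, c n) * (C * (j + 1).factorial * R ^ (j + 1)) with hB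
  have hB0 : 0 ≤ ∑ i ∈ Finset.range (l₀ + 2), B i := Finset.sum_nonneg fun i _ => by positivity
  set μ := min (m / (2 * d)) (m' / (2 * (F'.card + 1))) with hμ
  have hμ0 : 0 < μ := lt_min (by positivity) (by positivity)
  refine ⟨l₀, le_max_left _ _, (∑ i ∈ Finset.range (l₀ + 2), B i) + μ + 1, μ, hμ0,
    by linarith, ?_⟩
  rintro T ⟨b, k, hk, hb, hT⟩
  have hpK : ((fun n => b (n + 1), fun n => (k (n + 1) : ℝ)) : (ℕ → ℝ) × (ℕ → ℝ)) ∈ K :=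
    ⟨fun n _ => abs_le.1 (hb (n + 1) (by lia)), fun n _ =>
      ⟨Nat.cast_nonneg _, (Nat.cast_le.2 (hk (n + 1) (by lia)).le).trans_eq (Nat.cast_pow d _)⟩⟩
  set p : K := ⟨_, hpK⟩ with hp
  have hTS : T = shiftSeries d φ 0 p.1.1 p.1.2 := by
    funext θ
    rw [hT θ]
    simp [shiftSeries, hp]
  have hderiv : ∀ i, iteratedDeriv i T = shiftSeries d φ i p.1.1 p.1.2 := fun i => by
    rw [hTS, iteratedDeriv_shiftSeries hD.le hf hM hc (hKb p)]
  have hbound : ∀ i θ, |iteratedDeriv i T θ| ≤ B i := fun i θ => by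
    rw [hderiv]
    exact abs_shiftSeries_le hD.le (hCR (i + 1)) hc (hKb p) _ _
  refine ⟨fun θ hθ => ⟨?_, ?_, ?_⟩, ?_⟩
  · refine (Finset.sum_le_sum fun i _ => hbound i θ).trans ?_
    rw [le_div_iff₀ two_pos]
    exact mul_le_mul (by linarith) hD2 two_pos.le (by linarith)
  · exact Finset.sum_le_sum_of_subset_of_nonneg (Finset.range_mono (by lia))
      fun _ _ _ => abs_nonneg _
  · calc 2 * d * μ ≤ 2 * d * (m / (2 * d)) := by gcongr; exact min_le_left _ _
      _ = m := by field_simp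
      _ ≤ ∑ i ∈ F, |iteratedDeriv i T θ| := by
          simp_rw [hderiv]
          exact hF (p, ⟨θ, hθ⟩)
      _ ≤ _ := Finset.sum_le_sum_of_subset_of_nonneg (fun i hi => Finset.mem_range.2 <|
          Nat.lt_succ_of_le ((Finset.le_sup (f := id) hi).trans (le_max_right _ _)))
          fun _ _ _ => abs_nonneg _
  · have hbdd : BddAbove (range fun θ : Icc (0 : ℝ) 1 => |T θ|) := by
      refine ⟨B 0, ?_⟩
      rintro _ ⟨θ, rfl⟩
      simpa using hbound 0 θ
    set s := ⨆ θ : Icc (0 : ℝ) 1, |T (θ : ℝ)| with hs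
    have hs0 : 0 ≤ s := Real.iSup_nonneg fun _ => abs_nonneg _
    have hms : m' ≤ F'.card * s := by
      refine (hF' p).trans ?_
      rw [← nsmul_eq_mul]
      refine Finset.sum_le_card_nsmul _ _ _ fun θ _ => ?_
      rw [← hTS]
      exact le_ciSup hbdd θ
    calc 2 * μ ≤ 2 * (m' / (2 * (F'.card + 1))) := by gcongr; exact min_le_right _ _
      _ = m' / (F'.card + 1) := by field_simp
      _ ≤ s := by
          rw [div_le_iff₀ (by positivity)]
          linarith
end
end
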